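/- arXiv:1412.4724 — 8 statements merged into one kernel-verified Lean document; each statement's English description precedes it below -/
import Mathlib

section
/- Given reals a, b, c, there exists a probability measure μ on the finite set {−1,1}² ⊆ ℝ² with ⟨A⟩ = a, ⟨B⟩ = b, and ⟨AB⟩ = c if and only if −1 ≤ a ≤ 1, −1 ≤ b ≤ 1, and |a + b| − 1 ≤ c ≤ 1 − |a − b|. -/
open MeasureTheory

/-- `μ` is a probability measure on `ℝ × ℝ` concentrated on the finite set `{−1,1}²`. -/
def IsSignProb2 (μ : Measure (ℝ × ℝ)) : Prop :=
  IsProbabilityMeasure μ ∧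
    μ {p : ℝ × ℝ | ¬ ((p.1 = 1 ∨ p.1 = -1) ∧ (p.2 = 1 ∨ p.2 = -1))} = 0

/-- The expectation of `(1 + s A) (1 + t B)` in terms of the moments of `(A, B)`. -/
theorem IsSignProb2.integral_one_add_mul_one_add {μ : Measure (ℝ × ℝ)} (hμ : IsSignProb2 μ)
    (s t : ℝ) :
    ∫ p, (1 + s * p.1) * (1 + t * p.2) ∂μ =
      1 + s * ∫ p, p.1 ∂μ + t * ∫ p, p.2 ∂μ + s * t * ∫ p, p.1 * p.2 ∂μ := by
  obtain ⟨hprob, hnull⟩ := hμ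
  have hae : ∀ᵐ p ∂μ, (p.1 = 1 ∨ p.1 = -1) ∧ (p.2 = 1 ∨ p.2 = -1) := hnull
  have h1 : Integrable (fun p : ℝ × ℝ => p.1) μ :=
    .of_bound (by fun_prop) 1 (by filter_upwards [hae] with p hp; rcases hp.1 with h | h <;> simp [h])
  have h2 : Integrable (fun p : ℝ × ℝ => p.2) μ :=
    .of_bound (by fun_prop) 1 (by filter_upwards [hae] with p hp; rcases hp.2 with h | h <;> simp [h])
  have h12 : Integrable (fun p : ℝ × ℝ => p.1 * p.2) μ :=
    .of_bound (by fun_prop) 1 (by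
      filter_upwards [hae] with p hp
      rcases hp.1 with h | h <;> rcases hp.2 with h' | h' <;> simp [h, h'])
  have hexp : ∀ p : ℝ × ℝ, (1 + s * p.1) * (1 + t * p.2) =
      1 + s * p.1 + t * p.2 + s * t * (p.1 * p.2) := fun p => by ring
  simp_rw [hexp]
  rw [integral_add (by fun_prop) (by fun_prop), integral_add (by fun_prop) (by fun_prop),
    integral_add (by fun_prop) (by fun_prop)]
  simp only [integral_const_mul, integral_const, probReal_univ, one_smul]

theorem IsSignProb2.integral_one_add_mul_one_add_nonneg {μ : Measure (ℝ × ℝ)}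
    (hμ : IsSignProb2 μ) {s t : ℝ} (hs : |s| ≤ 1) (ht : |t| ≤ 1) :
    0 ≤ ∫ p, (1 + s * p.1) * (1 + t * p.2) ∂μ := by
  have hae : ∀ᵐ p ∂μ, (p.1 = 1 ∨ p.1 = -1) ∧ (p.2 = 1 ∨ p.2 = -1) := hμ.2
  rw [abs_le] at hs ht
  refine integral_nonneg_of_ae ?_
  filter_upwards [hae] with p hp
  refine mul_nonneg ?_ ?_
  · rcases hp.1 with h | h <;> rw [h] <;> linarith
  · rcases hp.2 with h | h <;> rw [h] <;> linarith

/-- The measure with masses `w`, `x`, `y`, `z` at `(1, 1)`, `(1, -1)`, `(-1, 1)`, `(-1, -1)`. -/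
noncomputable def signMeasure (w x y z : ℝ) : Measure (ℝ × ℝ) :=
  ENNReal.ofReal w • Measure.dirac (1, 1) + ENNReal.ofReal x • Measure.dirac (1, -1) +
    ENNReal.ofReal y • Measure.dirac (-1, 1) + ENNReal.ofReal z • Measure.dirac (-1, -1)

theorem isSignProb2_signMeasure {w x y z : ℝ} (hw : 0 ≤ w) (hx : 0 ≤ x) (hy : 0 ≤ y)
    (hz : 0 ≤ z) (hsum : w + x + y + z = 1) : IsSignProb2 (signMeasure w x y z) := by
  refine ⟨⟨?_⟩, ?_⟩
  · simp only [signMeasure, Measure.add_apply, Measure.smul_apply, measure_univ, smul_eq_mul,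
      mul_one]
    rw [← ENNReal.ofReal_add hw hx, ← ENNReal.ofReal_add (by positivity) hy,
      ← ENNReal.ofReal_add (by positivity) hz, hsum, ENNReal.ofReal_one]
  · simp [signMeasure]

theorem integral_signMeasure {w x y z : ℝ} (hw : 0 ≤ w) (hx : 0 ≤ x) (hy : 0 ≤ y)
    (hz : 0 ≤ z) (f : ℝ × ℝ → ℝ) :
    ∫ p, f p ∂signMeasure w x y z =
      w * f (1, 1) + x * f (1, -1) + y * f (-1, 1) + z * f (-1, -1) := by
  have hint (r : ℝ) (q : ℝ × ℝ) : Integrable f (ENNReal.ofReal r • Measure.dirac q) :=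
    (integrable_dirac (by simp)).smul_measure ENNReal.ofReal_ne_top
  rw [signMeasure,
    integral_add_measure (((hint _ _).add_measure (hint _ _)).add_measure (hint _ _)) (hint _ _),
    integral_add_measure ((hint _ _).add_measure (hint _ _)) (hint _ _),
    integral_add_measure (hint _ _) (hint _ _)]
  simp only [integral_smul_measure, integral_dirac, ENNReal.toReal_ofReal, hw, hx, hy, hz,
    smul_eq_mul]

theorem stmt2 (a b c : ℝ) :
    (∃ μ : Measure (ℝ × ℝ), IsSignProb2 μ ∧
        (∫ p, p.1 ∂μ) = a ∧ (∫ p, p.2 ∂μ) = b ∧ (∫ p, p.1 * p.2 ∂μ) = c) ↔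
      (-1 ≤ a ∧ a ≤ 1) ∧ (-1 ≤ b ∧ b ≤ 1) ∧ (|a + b| - 1 ≤ c ∧ c ≤ 1 - |a - b|) := by
  constructor
  · rintro ⟨μ, hμ, rfl, rfl, rfl⟩
    have key {s t : ℝ} (hs : |s| ≤ 1) (ht : |t| ≤ 1) :=
      (hμ.integral_one_add_mul_one_add_nonneg hs ht).trans_eq
        (hμ.integral_one_add_mul_one_add s t)
    have hpos : |(1 : ℝ)| ≤ 1 := by simp
    have hneg : |(-1 : ℝ)| ≤ 1 := by simp
    have hpp := key hpos hpos
    have hpn := key hpos hneg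
    have hnp := key hneg hpos
    have hnn := key hneg hneg
    rw [sub_le_iff_le_add, le_sub_comm, abs_le, abs_le]
    refine ⟨⟨?_, ?_⟩, ⟨?_, ?_⟩, ⟨?_, ?_⟩, ⟨?_, ?_⟩⟩ <;> linarith
  · rintro ⟨-, -, h1, h2⟩
    rw [sub_le_iff_le_add, abs_le] at h1
    rw [le_sub_comm, abs_le] at h2
    obtain ⟨h1l, h1r⟩ := h1
    obtain ⟨h2l, h2r⟩ := h2
    have hw : 0 ≤ (1 + a + b + c) / 4 := by linarith
    have hx : 0 ≤ (1 + a - b - c) / 4 := by linarith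
    have hy : 0 ≤ (1 - a + b - c) / 4 := by linarith
    have hz : 0 ≤ (1 - a - b + c) / 4 := by linarith
    refine ⟨_, isSignProb2_signMeasure hw hx hy hz (by ring), ?_, ?_, ?_⟩ <;>
      rw [integral_signMeasure hw hx hy hz] <;> ring
end

section
/- Given reals a, b, c, u, v, w, there exists a probability measure μ on the finite set {−1,1}³ ⊆ ℝ³ with ⟨A⟩ = a, ⟨B⟩ = b, ⟨C⟩ = c, ⟨AB⟩ = u, ⟨BC⟩ = v, ⟨CA⟩ = w if and only if each of the three pairs satisfies the two-variable conditions (namely −1 ≤ a, b, c ≤ 1, |a + b| − 1 ≤ u ≤ 1 − |a − b|, |b + c| − 1 ≤ v ≤ 1 − |b − c|, |c + a| − 1 ≤ w ≤ 1 − |c − a|) and additionally s₁(u, v, w) ≤ 1. -/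
open MeasureTheory

/-- `s₁(x₁,…,xₖ)`: the maximum of `∑ ιᵢ xᵢ` over sign vectors `ι ∈ {−1,1}ᵏ`
with an odd number of `−1`'s (equivalently, `∏ ιᵢ = −1`). -/
noncomputable def s1 {k : ℕ} (x : Fin k → ℝ) : ℝ :=
  sSup {y | ∃ ι : Fin k → ℝ, (∀ i, ι i = 1 ∨ ι i = -1) ∧ (∏ i, ι i) = -1 ∧ y = ∑ i, ι i * x i}

/-- `μ` is a probability measure on `ℝ × ℝ × ℝ` concentrated on the finite set `{−1,1}³`,
with coordinates `(A, B, C) = (p.1, p.2.1, p.2.2)`. -/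
def IsSignProb3 (μ : Measure (ℝ × ℝ × ℝ)) : Prop :=
  IsProbabilityMeasure μ ∧
    μ {p : ℝ × ℝ × ℝ |
        ¬ ((p.1 = 1 ∨ p.1 = -1) ∧ (p.2.1 = 1 ∨ p.2.1 = -1) ∧ (p.2.2 = 1 ∨ p.2.2 = -1))} = 0

theorem s1_le_iff {k : ℕ} (x : Fin k → ℝ) {r : ℝ} (hr : 0 ≤ r) :
    s1 x ≤ r ↔ ∀ ι : Fin k → ℝ, (∀ i, ι i = 1 ∨ ι i = -1) → (∏ i, ι i) = -1 →
      ∑ i, ι i * x i ≤ r := by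
  constructor
  · intro h ι hι hprod
    unfold s1 at h
    refine (le_csSup ?_ ?_).trans h
    swap
    · exact ⟨ι, hι, hprod, rfl⟩
    refine ⟨∑ i, |x i|, ?_⟩
    rintro y ⟨κ, hκ, -, rfl⟩
    refine Finset.sum_le_sum fun i _ => ?_
    rcases hκ i with h | h <;> rw [h]
    · simpa using le_abs_self (x i)
    · simpa using neg_le_abs (x i)
  · intro h
    refine Real.sSup_le ?_ hr
    rintro y ⟨ι, hι, hprod, rfl⟩
    exact h ι hι hprod

theorem s1_three_le_one_iff (u v w : ℝ) :
    s1 ![u, v, w] ≤ 1 ↔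
      -u + v + w ≤ 1 ∧ u - v + w ≤ 1 ∧ u + v - w ≤ 1 ∧ -u - v - w ≤ 1 := by
  rw [s1_le_iff _ zero_le_one]
  constructor
  · intro h
    have key (x y z : ℝ) (hx : x = 1 ∨ x = -1) (hy : y = 1 ∨ y = -1) (hz : z = 1 ∨ z = -1)
        (hxyz : x * y * z = -1) : x * u + y * v + z * w ≤ 1 := by
      have := h ![x, y, z] (by simp [Fin.forall_fin_succ, hx, hy, hz])
        (by simpa [Fin.prod_univ_three] using hxyz)
      simpa [Fin.sum_univ_three] using this
    have h₁ := key (-1) 1 1 (by simp) (by simp) (by simp) (by norm_num)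
    have h₂ := key 1 (-1) 1 (by simp) (by simp) (by simp) (by norm_num)
    have h₃ := key 1 1 (-1) (by simp) (by simp) (by simp) (by norm_num)
    have h₄ := key (-1) (-1) (-1) (by simp) (by simp) (by simp) (by norm_num)
    refine ⟨?_, ?_, ?_, ?_⟩ <;> linarith
  · rintro ⟨h₁, h₂, h₃, h₄⟩ ι hι hprod
    simp only [Fin.sum_univ_three, Fin.prod_univ_three, Matrix.cons_val] at hprod ⊢
    rcases hι 0 with h0 | h0 <;> rcases hι 1 with h1 | h1 <;> rcases hι 2 with h2 | h2 <;>
      rw [h0, h1, h2] at hprod ⊢ <;> linarith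

theorem IsSignProb3.ae_sign {μ : Measure (ℝ × ℝ × ℝ)} (hμ : IsSignProb3 μ) :
    ∀ᵐ p ∂μ, (p.1 = 1 ∨ p.1 = -1) ∧ (p.2.1 = 1 ∨ p.2.1 = -1) ∧ (p.2.2 = 1 ∨ p.2.2 = -1) :=
  hμ.2

/-- A quadratic form without square terms that is nonnegative on `{−1,1}³` has nonnegative
expectation. -/
theorem IsSignProb3.expectation_nonneg {μ : Measure (ℝ × ℝ × ℝ)} (hμ : IsSignProb3 μ)
    (k x y z r s t : ℝ)
    (h : ∀ α β γ : ℝ, (α = 1 ∨ α = -1) → (β = 1 ∨ β = -1) → (γ = 1 ∨ γ = -1) →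
      0 ≤ k + x * α + y * β + z * γ + r * (α * β) + s * (β * γ) + t * (γ * α)) :
    0 ≤ k + x * (∫ p, p.1 ∂μ) + y * (∫ p, p.2.1 ∂μ) + z * (∫ p, p.2.2 ∂μ)
      + r * (∫ p, p.1 * p.2.1 ∂μ) + s * (∫ p, p.2.1 * p.2.2 ∂μ)
      + t * (∫ p, p.2.2 * p.1 ∂μ) := by
  have := hμ.1
  have hi (f : ℝ × ℝ × ℝ → ℝ) (hf : Measurable f)
      (hb : ∀ p : ℝ × ℝ × ℝ, (p.1 = 1 ∨ p.1 = -1) → (p.2.1 = 1 ∨ p.2.1 = -1) →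
        (p.2.2 = 1 ∨ p.2.2 = -1) → ‖f p‖ ≤ 1) : Integrable f μ :=
    .of_bound hf.aestronglyMeasurable 1
      (hμ.ae_sign.mono fun p hp => hb p hp.1 hp.2.1 hp.2.2)
  have hA : Integrable (fun p : ℝ × ℝ × ℝ => p.1) μ := hi _ (by fun_prop) (by
    rintro p (h | h) - - <;> simp [h])
  have hB : Integrable (fun p : ℝ × ℝ × ℝ => p.2.1) μ := hi _ (by fun_prop) (by
    rintro p - (h | h) - <;> simp [h])
  have hC : Integrable (fun p : ℝ × ℝ × ℝ => p.2.2) μ := hi _ (by fun_prop) (by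
    rintro p - - (h | h) <;> simp [h])
  have hAB : Integrable (fun p : ℝ × ℝ × ℝ => p.1 * p.2.1) μ := hi _ (by fun_prop) (by
    rintro p (h | h) (h' | h') - <;> simp [h, h'])
  have hBC : Integrable (fun p : ℝ × ℝ × ℝ => p.2.1 * p.2.2) μ := hi _ (by fun_prop) (by
    rintro p - (h | h) (h' | h') <;> simp [h, h'])
  have hCA : Integrable (fun p : ℝ × ℝ × ℝ => p.2.2 * p.1) μ := hi _ (by fun_prop) (by
    rintro p (h | h) - (h' | h') <;> simp [h, h'])
  have hint : 0 ≤ ∫ p, (k + x * p.1 + y * p.2.1 + z * p.2.2 + r * (p.1 * p.2.1)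
      + s * (p.2.1 * p.2.2) + t * (p.2.2 * p.1)) ∂μ :=
    integral_nonneg_of_ae (hμ.ae_sign.mono fun p hp => h _ _ _ hp.1 hp.2.1 hp.2.2)
  rw [integral_add (by fun_prop) (by fun_prop), integral_add (by fun_prop) (by fun_prop),
    integral_add (by fun_prop) (by fun_prop), integral_add (by fun_prop) (by fun_prop),
    integral_add (by fun_prop) (by fun_prop), integral_add (by fun_prop) (by fun_prop)] at hint
  simpa only [integral_const_mul, integral_const, probReal_univ, one_smul] using hint

/-- A finitely supported probability measure with prescribed weights. -/
theorem exists_isProbabilityMeasure_integral_eq_sum {ι E : Type*} [Fintype ι]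
    [MeasurableSpace E] [MeasurableSingletonClass E] (q : ι → ℝ) (x : ι → E)
    (hq : ∀ i, 0 ≤ q i) (hsum : ∑ i, q i = 1) :
    ∃ μ : Measure E, IsProbabilityMeasure μ ∧ (∀ s : Set E, (∀ i, x i ∉ s) → μ s = 0) ∧
      ∀ f : E → ℝ, ∫ p, f p ∂μ = ∑ i, q i * f (x i) := by
  refine ⟨∑ i, ENNReal.ofReal (q i) • Measure.dirac (x i), ⟨?_⟩, ?_, ?_⟩
  · simp [← ENNReal.ofReal_sum_of_nonneg fun i _ => hq i, hsum]
  · intro s hs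
    simp [Measure.finsetSum_apply, hs]
  · intro f
    rw [integral_finsetSum_measure fun i _ =>
      (integrable_dirac (by simp)).smul_measure ENNReal.ofReal_ne_top]
    simp [integral_smul_measure, hq]

/-- The third-order moment `t` is chosen so that all eight point masses are nonnegative. -/
theorem exists_third_moment {a b c u v w : ℝ}
    (hu : |a + b| - 1 ≤ u ∧ u ≤ 1 - |a - b|) (hv : |b + c| - 1 ≤ v ∧ v ≤ 1 - |b - c|)
    (hw : |c + a| - 1 ≤ w ∧ w ≤ 1 - |c - a|)
    (hs : -u + v + w ≤ 1 ∧ u - v + w ≤ 1 ∧ u + v - w ≤ 1 ∧ -u - v - w ≤ 1) :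
    ∃ t : ℝ, ∀ α β γ : ℝ, (α = 1 ∨ α = -1) → (β = 1 ∨ β = -1) → (γ = 1 ∨ γ = -1) →
      0 ≤ 1 + a * α + b * β + c * γ + u * (α * β) + v * (β * γ) + w * (γ * α)
        + t * (α * β * γ) := by
  obtain ⟨hu₁, hu₂⟩ := hu
  obtain ⟨hv₁, hv₂⟩ := hv
  obtain ⟨hw₁, hw₂⟩ := hw
  obtain ⟨hs₁, hs₂, hs₃, hs₄⟩ := hs
  rw [sub_le_iff_le_add, abs_le] at hu₁ hv₁ hw₁
  rw [le_sub_comm, abs_le] at hu₂ hv₂ hw₂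
  set m := max (max (-(1 + a + b + c + u + v + w)) (-(1 + a - b - c - u + v - w)))
    (max (-(1 - a + b - c - u - v + w)) (-(1 - a - b + c + u - v - w))) with hm
  obtain ⟨⟨h₁, h₂⟩, h₃, h₄⟩ := (by simpa only [max_le_iff] using hm.ge :
    (-(1 + a + b + c + u + v + w) ≤ m ∧ -(1 + a - b - c - u + v - w) ≤ m) ∧
      -(1 - a + b - c - u - v + w) ≤ m ∧ -(1 - a - b + c + u - v - w) ≤ m)
  have hle {r : ℝ} (e₁ : -(1 + a + b + c + u + v + w) ≤ r)
      (e₂ : -(1 + a - b - c - u + v - w) ≤ r) (e₃ : -(1 - a + b - c - u - v + w) ≤ r)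
      (e₄ : -(1 - a - b + c + u - v - w) ≤ r) : m ≤ r :=
    max_le (max_le e₁ e₂) (max_le e₃ e₄)
  have h₅ : m ≤ 1 - a - b - c + u + v + w := by apply hle <;> linarith
  have h₆ : m ≤ 1 - a + b + c - u + v - w := by apply hle <;> linarith
  have h₇ : m ≤ 1 + a - b + c - u - v + w := by apply hle <;> linarith
  have h₈ : m ≤ 1 + a + b - c + u - v - w := by apply hle <;> linarith
  refine ⟨m, ?_⟩
  rintro α β γ (rfl | rfl) (rfl | rfl) (rfl | rfl) <;> linarith

theorem stmt4 (a b c u v w : ℝ) :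
    (∃ μ : Measure (ℝ × ℝ × ℝ), IsSignProb3 μ ∧
        (∫ p, p.1 ∂μ) = a ∧ (∫ p, p.2.1 ∂μ) = b ∧ (∫ p, p.2.2 ∂μ) = c ∧
        (∫ p, p.1 * p.2.1 ∂μ) = u ∧ (∫ p, p.2.1 * p.2.2 ∂μ) = v ∧
        (∫ p, p.2.2 * p.1 ∂μ) = w) ↔
      ((-1 ≤ a ∧ a ≤ 1) ∧ (-1 ≤ b ∧ b ≤ 1) ∧ (-1 ≤ c ∧ c ≤ 1) ∧
        (|a + b| - 1 ≤ u ∧ u ≤ 1 - |a - b|) ∧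
        (|b + c| - 1 ≤ v ∧ v ≤ 1 - |b - c|) ∧
        (|c + a| - 1 ≤ w ∧ w ≤ 1 - |c - a|)) ∧
      s1 ![u, v, w] ≤ 1 := by
  rw [s1_three_le_one_iff]
  constructor
  · rintro ⟨μ, hμ, rfl, rfl, rfl, rfl, rfl, rfl⟩
    have key := hμ.expectation_nonneg
    have hAB (α β : ℝ) (hα : α = 1 ∨ α = -1) (hβ : β = 1 ∨ β = -1) :=
      key 1 α β 0 (α * β) 0 0 (by
        rcases hα with rfl | rfl <;> rcases hβ with rfl | rfl <;>
          rintro _ _ _ (rfl | rfl) (rfl | rfl) (rfl | rfl) <;> norm_num)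
    have hBC (β γ : ℝ) (hβ : β = 1 ∨ β = -1) (hγ : γ = 1 ∨ γ = -1) :=
      key 1 0 β γ 0 (β * γ) 0 (by
        rcases hβ with rfl | rfl <;> rcases hγ with rfl | rfl <;>
          rintro _ _ _ (rfl | rfl) (rfl | rfl) (rfl | rfl) <;> norm_num)
    have hCA (γ α : ℝ) (hγ : γ = 1 ∨ γ = -1) (hα : α = 1 ∨ α = -1) :=
      key 1 α 0 γ 0 0 (γ * α) (by
        rcases hγ with rfl | rfl <;> rcases hα with rfl | rfl <;>
          rintro _ _ _ (rfl | rfl) (rfl | rfl) (rfl | rfl) <;> norm_num)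
    have hABC (α β γ : ℝ) (hα : α = 1 ∨ α = -1) (hβ : β = 1 ∨ β = -1)
        (hγ : γ = 1 ∨ γ = -1) :=
      key 1 0 0 0 (α * β) (β * γ) (γ * α) (by
        rcases hα with rfl | rfl <;> rcases hβ with rfl | rfl <;> rcases hγ with rfl | rfl <;>
          rintro _ _ _ (rfl | rfl) (rfl | rfl) (rfl | rfl) <;> norm_num)
    have h₁ : (1 : ℝ) = 1 ∨ (1 : ℝ) = -1 := .inl rfl
    have h₂ : (-1 : ℝ) = 1 ∨ (-1 : ℝ) = -1 := .inr rfl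
    simp only [sub_le_iff_le_add, abs_le]
    refine ⟨?_, ?_⟩
    · have := hAB 1 1 h₁ h₁
      have := hAB 1 (-1) h₁ h₂
      have := hAB (-1) 1 h₂ h₁
      have := hAB (-1) (-1) h₂ h₂
      have := hBC 1 1 h₁ h₁
      have := hBC 1 (-1) h₁ h₂
      have := hBC (-1) 1 h₂ h₁
      have := hBC (-1) (-1) h₂ h₂
      have := hCA 1 1 h₁ h₁
      have := hCA 1 (-1) h₁ h₂
      have := hCA (-1) 1 h₂ h₁
      have := hCA (-1) (-1) h₂ h₂
      refine ⟨⟨?_, ?_⟩, ⟨?_, ?_⟩, ⟨?_, ?_⟩, ⟨⟨?_, ?_⟩, ?_⟩, ⟨⟨?_, ?_⟩, ?_⟩,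
        ⟨⟨?_, ?_⟩, ?_⟩⟩ <;> first | linarith | (rw [le_sub_comm, abs_le]; constructor <;> linarith)
    · have := hABC 1 1 1 h₁ h₁ h₁
      have := hABC (-1) 1 1 h₂ h₁ h₁
      have := hABC 1 (-1) 1 h₁ h₂ h₁
      have := hABC 1 1 (-1) h₁ h₁ h₂
      refine ⟨?_, ?_, ?_, ?_⟩ <;> linarith
  · rintro ⟨⟨-, -, -, hu, hv, hw⟩, hs⟩
    obtain ⟨t, ht⟩ := exists_third_moment hu hv hw hs
    let σ : Bool → ℝ := fun i => if i then 1 else -1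
    have hσ (i : Bool) : σ i = 1 ∨ σ i = -1 := by cases i <;> simp [σ]
    obtain ⟨μ, hprob, hnull, hint⟩ := exists_isProbabilityMeasure_integral_eq_sum
      (fun i : Bool × Bool × Bool => (1 + a * σ i.1 + b * σ i.2.1 + c * σ i.2.2
        + u * (σ i.1 * σ i.2.1) + v * (σ i.2.1 * σ i.2.2) + w * (σ i.2.2 * σ i.1)
        + t * (σ i.1 * σ i.2.1 * σ i.2.2)) / 8)
      (fun i => (σ i.1, σ i.2.1, σ i.2.2))
      (fun i => div_nonneg (ht _ _ _ (hσ _) (hσ _) (hσ _)) (by norm_num))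
      (by simp [Fintype.sum_prod_type, σ]; ring)
    refine ⟨μ, ⟨hprob, hnull _ fun i => ?_⟩, ?_, ?_, ?_, ?_, ?_, ?_⟩
    · exact not_not_intro ⟨hσ i.1, hσ i.2.1, hσ i.2.2⟩
    all_goals
      rw [hint]
      simp [Fintype.sum_prod_type, σ]
      ring
end

section
/- Let X, Y, Z be nonempty finite types, let μ be a probability measure on X × Y and ν a probability measure on Y × Z. There exists a probability measure on X × Y × Z whose marginal on X × Y equals μ and whose marginal on Y × Z equals ν if and only if the marginal of μ on Y equals the marginal of ν on Y. -/
open MeasureTheory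

/-- The pushforward of a composition-product along a map of its first factor. -/
theorem map_compProd_comap {A B C : Type*} [MeasurableSpace A] [MeasurableSpace B]
    [MeasurableSpace C] (μ : Measure A) [SFinite μ] (η : ProbabilityTheory.Kernel B C)
    [ProbabilityTheory.IsSFiniteKernel η] {f : A → B} (hf : Measurable f) :
    (μ.compProd (η.comap f hf)).map (Prod.map f id) = (μ.map f).compProd η := by
  ext s hs
  have hfi : Measurable (Prod.map f (id : C → C)) := hf.prodMap measurable_id
  rw [Measure.map_apply hfi hs, Measure.compProd_apply (hfi hs), Measure.compProd_apply hs,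
    lintegral_map (ProbabilityTheory.Kernel.measurable_kernel_prodMk_left hs) hf]
  rfl

theorem stmt5 {X Y Z : Type} [Fintype X] [Fintype Y] [Fintype Z]
    [Nonempty X] [Nonempty Y] [Nonempty Z]
    [MeasurableSpace X] [MeasurableSpace Y] [MeasurableSpace Z]
    [MeasurableSingletonClass X] [MeasurableSingletonClass Y] [MeasurableSingletonClass Z]
    (μ : Measure (X × Y)) (ν : Measure (Y × Z))
    (hμ : IsProbabilityMeasure μ) (hν : IsProbabilityMeasure ν) :
    (∃ κ : Measure (X × Y × Z), IsProbabilityMeasure κ ∧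
        κ.map (fun p => (p.1, p.2.1)) = μ ∧ κ.map Prod.snd = ν) ↔
      μ.map Prod.snd = ν.map Prod.fst := by
  constructor
  · rintro ⟨κ, -, rfl, rfl⟩
    rw [Measure.map_map measurable_snd (by fun_prop), Measure.map_map measurable_fst measurable_snd]
    rfl
  · intro h
    set ρ : Measure ((X × Y) × Z) := μ.compProd (ν.condKernel.comap Prod.snd measurable_snd)
    have hassoc : Measurable (MeasurableEquiv.prodAssoc : (X × Y) × Z ≃ᵐ X × Y × Z) :=
      MeasurableEquiv.prodAssoc.measurable
    refine ⟨ρ.map MeasurableEquiv.prodAssoc,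
      Measure.isProbabilityMeasure_map hassoc.aemeasurable, ?_, ?_⟩
    · rw [Measure.map_map (by fun_prop) hassoc]
      exact Measure.fst_compProd μ _
    · rw [Measure.map_map measurable_snd hassoc]
      calc ρ.map (Prod.map Prod.snd id) = (μ.map Prod.snd).compProd ν.condKernel :=
            map_compProd_comap μ ν.condKernel measurable_snd
        _ = ν.fst.compProd ν.condKernel := by rw [h]; rfl
        _ = ν := ν.disintegrate ν.condKernel
end

section
/- Let n ≥ 2 and let v₁,…,vₙ and c₁,…,c_{n−1} be reals. There exists a probability measure μ on {−1,1}ⁿ ⊆ ℝⁿ with ⟨Aᵢ⟩ = vᵢ for i = 1,…,n and ⟨AᵢAᵢ₊₁⟩ = cᵢ for i = 1,…,n−1 if and only if for every i = 1,…,n−1 one has −1 ≤ vᵢ ≤ 1, −1 ≤ vᵢ₊₁ ≤ 1, and |vᵢ + vᵢ₊₁| − 1 ≤ cᵢ ≤ 1 − |vᵢ − vᵢ₊₁|. -/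
open MeasureTheory

/-- `μ` is a probability measure on `Fin n → ℝ` concentrated on the finite set `{−1,1}ⁿ`. -/
def IsSignProb {n : ℕ} (μ : Measure (Fin n → ℝ)) : Prop :=
  IsProbabilityMeasure μ ∧ μ {A : Fin n → ℝ | ¬ ∀ i, A i = 1 ∨ A i = -1} = 0

/-- A transition from a sign of mean `a` to a sign of mean `b` with correlation `c`, as the
conditional mean `x + y * s` of the new sign given the old sign `s`. -/
lemma exists_conditional_mean {a b c : ℝ} (h₁ : 0 ≤ 1 + a + b + c) (h₂ : 0 ≤ 1 + a - b - c)
    (h₃ : 0 ≤ 1 - a + b - c) (h₄ : 0 ≤ 1 - a - b + c) :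
    ∃ x y : ℝ, x + y * a = b ∧ x * a + y = c ∧ |x + y| ≤ 1 ∧ |x - y| ≤ 1 := by
  rcases eq_or_ne a 1 with rfl | ha₁
  · exact ⟨b, 0, by ring, by linarith, by rw [abs_le]; constructor <;> linarith,
      by rw [abs_le]; constructor <;> linarith⟩
  rcases eq_or_ne a (-1) with rfl | ha₂
  · exact ⟨b, 0, by ring, by linarith, by rw [abs_le]; constructor <;> linarith,
      by rw [abs_le]; constructor <;> linarith⟩
  have hp : 0 < 1 + a := lt_of_le_of_ne (by linarith) fun h => ha₂ (by linarith)
  have hm : 0 < 1 - a := lt_of_le_of_ne (by linarith) fun h => ha₁ (by linarith)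
  refine ⟨((b + c) / (1 + a) + (b - c) / (1 - a)) / 2,
    ((b + c) / (1 + a) - (b - c) / (1 - a)) / 2, ?_, ?_, ?_, ?_⟩
  · field_simp
    ring
  · field_simp
    ring
  · rw [show ∀ p q : ℝ, (p + q) / 2 + (p - q) / 2 = p by intros; ring, abs_le,
      le_div_iff₀ hp, div_le_iff₀ hp]
    constructor <;> linarith
  · rw [show ∀ p q : ℝ, (p + q) / 2 - (p - q) / 2 = q by intros; ring, abs_le,
      le_div_iff₀ hm, div_le_iff₀ hm]
    constructor <;> linarith

/-- A chain of signs on a finite weighted space with prescribed means and consecutive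
correlations. -/
lemma exists_sign_chain (v c : ℕ → ℝ) (hv : |v 0| ≤ 1) (m : ℕ)
    (h : ∀ i < m, 0 ≤ 1 + v i + v (i + 1) + c i ∧ 0 ≤ 1 + v i - v (i + 1) - c i ∧
      0 ≤ 1 - v i + v (i + 1) - c i ∧ 0 ≤ 1 - v i - v (i + 1) + c i) :
    ∃ (Ω : Type) (_ : Fintype Ω) (p : Ω → ℝ) (X : ℕ → Ω → ℝ),
      (∀ ω, 0 ≤ p ω) ∧ ∑ ω, p ω = 1 ∧ (∀ i ω, X i ω = 1 ∨ X i ω = -1) ∧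
      (∀ i ≤ m, ∑ ω, p ω * X i ω = v i) ∧
      ∀ i < m, ∑ ω, p ω * (X i ω * X (i + 1) ω) = c i := by
  induction m with
  | zero =>
    rw [abs_le] at hv
    refine ⟨Bool, inferInstance, fun b => cond b ((1 + v 0) / 2) ((1 - v 0) / 2),
      fun _ b => cond b 1 (-1), ?_, ?_, ?_, ?_, ?_⟩
    · rintro (_ | _) <;> simp only [cond_true, cond_false] <;> linarith
    · simp only [Fintype.sum_bool, cond_true, cond_false]
      ring
    · rintro _ (_ | _) <;> simp
    · intro i hi
      obtain rfl : i = 0 := by omega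
      simp only [Fintype.sum_bool, cond_true, cond_false]
      ring
    · intro i hi
      omega
  | succ m ih =>
    obtain ⟨Ω, _, p, X, hp, hsum, hX, hmean, hcorr⟩ := ih fun i hi => h i (by omega)
    obtain ⟨h₁, h₂, h₃, h₄⟩ := h m (by omega)
    obtain ⟨x, y, hb, hc, hxy, hxy'⟩ := exists_conditional_mean h₁ h₂ h₃ h₄
    rw [abs_le] at hxy hxy'
    have marginal (f : Ω → ℝ) :
        ∑ ω : Ω × Bool, p ω.1 * ((1 + cond ω.2 1 (-1) * (x + y * X m ω.1)) / 2) * f ω.1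
          = ∑ ω, p ω * f ω := by
      rw [Fintype.sum_prod_type]
      refine Finset.sum_congr rfl fun ω _ => ?_
      simp only [Fintype.sum_bool, cond_true, cond_false]
      ring
    have transition (f : Ω → ℝ) :
        ∑ ω : Ω × Bool, p ω.1 * ((1 + cond ω.2 1 (-1) * (x + y * X m ω.1)) / 2) *
            (f ω.1 * cond ω.2 1 (-1))
          = x * ∑ ω, p ω * f ω + y * ∑ ω, p ω * (f ω * X m ω) := by
      rw [Fintype.sum_prod_type, Finset.mul_sum, Finset.mul_sum, ← Finset.sum_add_distrib]
      refine Finset.sum_congr rfl fun ω _ => ?_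
      simp only [Fintype.sum_bool, cond_true, cond_false]
      ring
    refine ⟨Ω × Bool, inferInstance,
      fun ω => p ω.1 * ((1 + cond ω.2 1 (-1) * (x + y * X m ω.1)) / 2),
      fun i ω => if i = m + 1 then cond ω.2 1 (-1) else X i ω.1, ?_, ?_, ?_, ?_, ?_⟩
    · rintro ⟨ω, b⟩
      refine mul_nonneg (hp ω) ?_
      rcases hX m ω with hω | hω <;> cases b <;> simp only [hω, cond_true, cond_false] <;> linarith
    · simpa [hsum] using marginal fun _ => 1
    · rintro i ⟨ω, b⟩
      by_cases hi : i = m + 1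
      · cases b <;> simp [hi]
      · simpa [hi] using hX i ω
    · intro i hi
      by_cases him : i = m + 1
      · subst him
        have := transition fun _ => 1
        simp only [one_mul, mul_one, hsum, hmean m le_rfl] at this
        simpa only [if_true, hb] using this
      · simpa only [him, if_false] using (marginal (X i)).trans (hmean i (by omega))
    · intro i hi
      by_cases him : i = m
      · subst him
        have hsq : ∑ ω, p ω * (X i ω * X i ω) = 1 := by
          rw [← hsum]
          refine Finset.sum_congr rfl fun ω _ => ?_
          rcases hX i ω with hω | hω <;> simp [hω]
        have := transition (X i)
        rw [hsq, hmean i le_rfl, mul_one, hc] at this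
        simpa using this
      · have h₁ : i ≠ m + 1 := by omega
        have h₂ : i + 1 ≠ m + 1 := by omega
        simpa only [h₁, h₂, if_false] using
          (marginal fun ω => X i ω * X (i + 1) ω).trans (hcorr i (by omega))

/-- A finite family of sign vectors with nonnegative weights of total `1` gives a sign measure
whose integrals are the weighted sums. -/
lemma exists_isSignProb_of_weights {n : ℕ} {Ω : Type*} [Fintype Ω] (p : Ω → ℝ)
    (X : Ω → Fin n → ℝ) (hp : ∀ ω, 0 ≤ p ω) (hsum : ∑ ω, p ω = 1)
    (hX : ∀ ω i, X ω i = 1 ∨ X ω i = -1) :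
    ∃ μ : Measure (Fin n → ℝ), IsSignProb μ ∧
      ∀ f : (Fin n → ℝ) → ℝ, ∫ A, f A ∂μ = ∑ ω, p ω * f (X ω) := by
  refine ⟨∑ ω, ENNReal.ofReal (p ω) • Measure.dirac (X ω), ⟨⟨?_⟩, ?_⟩, fun f => ?_⟩
  · simp [Measure.finsetSum_apply, ← ENNReal.ofReal_sum_of_nonneg fun ω _ => hp ω, hsum]
  · simp only [Measure.coe_finsetSum, Finset.sum_apply, Measure.smul_apply, smul_eq_mul]
    refine Finset.sum_eq_zero fun ω _ => ?_
    rw [Measure.dirac_apply, Set.indicator_of_notMem, mul_zero]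
    exact fun h => h (hX ω)
  · rw [integral_finsetSum_measure]
    · refine Finset.sum_congr rfl fun ω _ => ?_
      rw [integral_smul_measure, integral_dirac, ENNReal.toReal_ofReal (hp ω), smul_eq_mul]
    · intro ω _
      exact (integrable_dirac (by simp)).smul_measure ENNReal.ofReal_ne_top

/-- The nonnegativity of the pair probabilities of two coordinates of a sign vector. -/
lemma IsSignProb.pair_nonneg {n : ℕ} {μ : Measure (Fin n → ℝ)} (hμ : IsSignProb μ) (i j : Fin n)
    {s t : ℝ} (hs : |s| = 1) (ht : |t| = 1) :
    0 ≤ 1 + s * (∫ A, A i ∂μ) + t * (∫ A, A j ∂μ) + s * t * ∫ A, A i * A j ∂μ := by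
  have := hμ.1
  have hsign : ∀ᵐ A ∂μ, ∀ i, A i = 1 ∨ A i = -1 := hμ.2
  have hint (k : Fin n) : Integrable (fun A : Fin n → ℝ => A k) μ := by
    refine Integrable.of_bound (Measurable.aestronglyMeasurable (by fun_prop)) 1 ?_
    filter_upwards [hsign] with A hA
    rcases hA k with h | h <;> simp [h]
  have hprod : Integrable (fun A : Fin n → ℝ => A i * A j) μ := by
    refine Integrable.of_bound (Measurable.aestronglyMeasurable (by fun_prop)) 1 ?_
    filter_upwards [hsign] with A hA
    rcases hA i with h | h <;> rcases hA j with h' | h' <;> simp [h, h']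
  have hnonneg : 0 ≤ ∫ A, (1 + s * A i + t * A j + s * t * (A i * A j)) ∂μ := by
    refine integral_nonneg_of_ae ?_
    filter_upwards [hsign] with A hA
    have habs (k : Fin n) : |A k| = 1 := by rcases hA k with h | h <;> simp [h]
    have h₁ : -1 ≤ s * A i := (abs_le.1 (by rw [abs_mul, hs, habs, one_mul])).1
    have h₂ : -1 ≤ t * A j := (abs_le.1 (by rw [abs_mul, ht, habs, one_mul])).1
    simp only [Pi.zero_apply]
    nlinarith [mul_nonneg (neg_le_iff_add_nonneg.1 h₁) (neg_le_iff_add_nonneg.1 h₂)]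
  have h₁ : Integrable (fun A : Fin n → ℝ => 1 + s * A i) μ :=
    (integrable_const _).add ((hint i).const_mul s)
  have h₂ : Integrable (fun A : Fin n → ℝ => 1 + s * A i + t * A j) μ :=
    h₁.add ((hint j).const_mul t)
  rw [integral_add h₂ (hprod.const_mul _), integral_add h₁ ((hint j).const_mul t),
    integral_add (integrable_const _) ((hint i).const_mul s)] at hnonneg
  simpa [integral_const_mul] using hnonneg

theorem stmt6 (n : ℕ) (hn : 2 ≤ n) (v : Fin n → ℝ) (c : Fin (n - 1) → ℝ) :
    (∃ μ : Measure (Fin n → ℝ), IsSignProb μ ∧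
        (∀ i : Fin n, (∫ A, A i ∂μ) = v i) ∧
        (∀ i : Fin (n - 1),
          (∫ A, A ⟨(i : ℕ), by have := i.isLt; omega⟩ *
              A ⟨(i : ℕ) + 1, by have := i.isLt; omega⟩ ∂μ) = c i)) ↔
      ∀ i : Fin (n - 1),
        (-1 ≤ v ⟨(i : ℕ), by have := i.isLt; omega⟩ ∧
            v ⟨(i : ℕ), by have := i.isLt; omega⟩ ≤ 1) ∧
        (-1 ≤ v ⟨(i : ℕ) + 1, by have := i.isLt; omega⟩ ∧
            v ⟨(i : ℕ) + 1, by have := i.isLt; omega⟩ ≤ 1) ∧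
        |v ⟨(i : ℕ), by have := i.isLt; omega⟩ + v ⟨(i : ℕ) + 1, by have := i.isLt; omega⟩| - 1
            ≤ c i ∧
        c i ≤ 1 -
          |v ⟨(i : ℕ), by have := i.isLt; omega⟩ - v ⟨(i : ℕ) + 1, by have := i.isLt; omega⟩| := by
  constructor
  · rintro ⟨μ, hμ, hv, hc⟩ i
    have pair {s t : ℝ} (hs : |s| = 1) (ht : |t| = 1) :=
      hμ.pair_nonneg ⟨(i : ℕ), by omega⟩ ⟨(i : ℕ) + 1, by omega⟩ hs ht
    simp only [hv, hc] at pair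
    have h₁ := pair (s := 1) (t := 1) (by simp) (by simp)
    have h₂ := pair (s := 1) (t := -1) (by simp) (by simp)
    have h₃ := pair (s := -1) (t := 1) (by simp) (by simp)
    have h₄ := pair (s := -1) (t := -1) (by simp) (by simp)
    refine ⟨⟨by linarith, by linarith⟩, ⟨by linarith, by linarith⟩, ?_, ?_⟩
    · rw [sub_le_iff_le_add, abs_le]
      constructor <;> linarith
    · rw [le_sub_comm, abs_le]
      constructor <;> linarith
  · intro h
    obtain ⟨Ω, _, p, X, hp, hsum, hX, hmean, hcorr⟩ := exists_sign_chain
      (fun k => if hk : k < n then v ⟨k, hk⟩ else 0)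
      (fun k => if hk : k < n - 1 then c ⟨k, hk⟩ else 0)
      (by
        have h₀ : 0 < n := by omega
        simpa only [h₀, dif_pos] using abs_le.2 (h ⟨0, by omega⟩).1) (n - 1)
      (by
        intro i hi
        have h₁ : i < n := by omega
        have h₂ : i + 1 < n := by omega
        simp only [hi, h₁, h₂, dif_pos]
        obtain ⟨-, -, hl, hu⟩ := h ⟨i, hi⟩
        rw [sub_le_iff_le_add, abs_le] at hl
        rw [le_sub_comm, abs_le] at hu
        exact ⟨by linarith, by linarith, by linarith, by linarith⟩)
    obtain ⟨μ, hμ, hint⟩ := exists_isSignProb_of_weights p (fun ω (i : Fin n) => X i ω) hp hsum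
      fun ω i => hX i ω
    refine ⟨μ, hμ, fun i => ?_, fun i => ?_⟩
    · rw [hint, hmean i (by omega), dif_pos i.isLt]
    · rw [hint, hcorr i i.isLt, dif_pos i.isLt]
end

section
/- Let n ≥ 2, and let λ₁,…,λₙ, μ₁,…,μₙ, c₁,…,cₙ be reals, indices taken cyclically (index n+1 means 1). Assume that for each i: −1 ≤ λᵢ ≤ 1, −1 ≤ μᵢ ≤ 1, and |λᵢ + μᵢ₊₁| − 1 ≤ cᵢ ≤ 1 − |λᵢ − μᵢ₊₁|. Then the following are equivalent: (1) there exists a probability measure on {−1,1}^{2n} ⊆ ℝ^{2n}, with coordinates labeled X₁,…,Xₙ, Y₁,…,Yₙ, such that for every i: ⟨Xᵢ⟩ = λᵢ, ⟨Yᵢ⟩ = μᵢ, ⟨XᵢYᵢ₊₁⟩ = cᵢ, and ⟨YᵢXᵢ⟩ = 1 − |λᵢ − μᵢ| (i.e., each 'connection' pair (Yᵢ, Xᵢ) attains the maximal correlation allowed by its marginals); (2) s₁(c₁, …, cₙ, 1 − |λ₁ − μ₁|, …, 1 − |λₙ − μₙ|) ≤ 2n − 2. -/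
open MeasureTheory

/-- Correlations `r` compatible with `±1`-valued marginals of expectations `a` and `b`. -/
def IsPairCorrelation (a b r : ℝ) : Prop := |a + b| - 1 ≤ r ∧ r ≤ 1 - |a - b|

/-- `r` completes `p` and `q` to the three pairwise correlations of `±1`-valued variables. -/
def IsTriangle (p q r : ℝ) : Prop := |p + q| - 1 ≤ r ∧ r ≤ 1 - |p - q|

lemma isPairCorrelation_iff {a b r : ℝ} : IsPairCorrelation a b r ↔
    a + b - 1 ≤ r ∧ -a - b - 1 ≤ r ∧ r ≤ 1 - a + b ∧ r ≤ 1 + a - b := by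
  unfold IsPairCorrelation
  constructor
  · rintro ⟨h1, h2⟩
    refine ⟨?_, ?_, ?_, ?_⟩ <;>
      linarith [le_abs_self (a + b), neg_abs_le (a + b), le_abs_self (a - b), neg_abs_le (a - b)]
  · rintro ⟨h1, h2, h3, h4⟩
    have h5 : |a + b| ≤ r + 1 := abs_le.2 ⟨by linarith, by linarith⟩
    have h6 : |a - b| ≤ 1 - r := abs_le.2 ⟨by linarith, by linarith⟩
    exact ⟨by linarith, by linarith⟩

lemma isTriangle_iff {p q r : ℝ} : IsTriangle p q r ↔
    p + q - 1 ≤ r ∧ -p - q - 1 ≤ r ∧ r ≤ 1 - p + q ∧ r ≤ 1 + p - q :=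
  isPairCorrelation_iff

lemma IsPairCorrelation.symm {a b r : ℝ} (h : IsPairCorrelation a b r) :
    IsPairCorrelation b a r := by
  rw [isPairCorrelation_iff] at *
  exact ⟨by linarith, by linarith, by linarith, by linarith⟩

/-- Three pairwise intersecting closed intervals have a common point. -/
lemma exists_mem_three_intervals {l₁ u₁ l₂ u₂ l₃ u₃ : ℝ} (h11 : l₁ ≤ u₁) (h12 : l₁ ≤ u₂)
    (h13 : l₁ ≤ u₃) (h21 : l₂ ≤ u₁) (h22 : l₂ ≤ u₂) (h23 : l₂ ≤ u₃) (h31 : l₃ ≤ u₁)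
    (h32 : l₃ ≤ u₂) (h33 : l₃ ≤ u₃) :
    ∃ r, (l₁ ≤ r ∧ r ≤ u₁) ∧ (l₂ ≤ r ∧ r ≤ u₂) ∧ (l₃ ≤ r ∧ r ≤ u₃) :=
  ⟨max l₁ (max l₂ l₃), ⟨by simp, by simp [*]⟩, ⟨by simp, by simp [*]⟩, ⟨by simp, by simp [*]⟩⟩

lemma abs_sum_sub_one_le_of_isPairCorrelation {a b c p q : ℝ} (hp : IsPairCorrelation a b p)
    (hq : IsPairCorrelation b c q) : |a + c| - 1 ≤ 1 - |p - q| ∧ |p + q| - 1 ≤ 1 - |a - c| := by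
  rw [isPairCorrelation_iff] at hp hq
  obtain ⟨p1, p2, p3, p4⟩ := hp
  obtain ⟨q1, q2, q3, q4⟩ := hq
  constructor
  · rcases abs_cases (a + c) with h | h <;> rcases abs_cases (p - q) with h' | h' <;> linarith
  · rcases abs_cases (a - c) with h | h <;> rcases abs_cases (p + q) with h' | h' <;> linarith

lemma abs_add_sub_one_le {a b : ℝ} (ha : -1 ≤ a ∧ a ≤ 1) (hb : -1 ≤ b ∧ b ≤ 1) :
    |a + b| - 1 ≤ 1 - |a - b| := by
  rcases abs_cases (a + b) with h | h <;> rcases abs_cases (a - b) with h' | h' <;> linarith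

lemma IsPairCorrelation.mem_Icc {a b r : ℝ} (h : IsPairCorrelation a b r) : -1 ≤ r ∧ r ≤ 1 :=
  ⟨by linarith [h.1, abs_nonneg (a + b)], by linarith [h.2, abs_nonneg (a - b)]⟩

/-- A conditional expectation of a third `±1`-valued variable given two others, with
prescribed moments. The expectation is `k₀ + k₁ x + k₂ y + k₃ x y` at the values `x`, `y`. -/
lemma exists_conditional_expectation {a b c p q r : ℝ} (hp : IsPairCorrelation a b p)
    (hq : IsPairCorrelation b c q) (hr : IsPairCorrelation a c r) (ht : IsTriangle p q r) :
    ∃ k₀ k₁ k₂ k₃ : ℝ,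
      (∀ x y : ℝ, (x = 1 ∨ x = -1) → (y = 1 ∨ y = -1) →
        |k₀ + k₁ * x + k₂ * y + k₃ * (x * y)| ≤ 1) ∧
      k₀ + k₁ * a + k₂ * b + k₃ * p = c ∧
      k₀ * a + k₁ + k₂ * p + k₃ * b = r ∧
      k₀ * b + k₁ * p + k₂ + k₃ * a = q := by
  rw [isPairCorrelation_iff] at hp hq hr
  rw [isTriangle_iff] at ht
  obtain ⟨p1, p2, p3, p4⟩ := hp
  obtain ⟨q1, q2, q3, q4⟩ := hq
  obtain ⟨r1, r2, r3, r4⟩ := hr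
  obtain ⟨t1, t2, t3, t4⟩ := ht
  obtain ⟨t, ht⟩ : ∃ t : ℝ,
      ((-(1 + a + b + p) - (c + r + q) ≤ t ∧ -(1 - a - b + p) - (c - r - q) ≤ t) ∧
        (c + r - q) - (1 + a - b - p) ≤ t ∧ (c - r + q) - (1 - a + b - p) ≤ t) ∧
      (t ≤ (1 + a + b + p) - (c + r + q) ∧ t ≤ (1 - a - b + p) - (c - r - q)) ∧
      t ≤ (c + r - q) + (1 + a - b - p) ∧ t ≤ (c - r + q) + (1 - a + b - p) := by
    refine ⟨max (max (-(1 + a + b + p) - (c + r + q)) (-(1 - a - b + p) - (c - r - q)))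
      (max ((c + r - q) - (1 + a - b - p)) ((c - r + q) - (1 - a + b - p))),
      ⟨⟨by simp, by simp⟩, by simp, by simp⟩, ⟨?_, ?_⟩, ?_, ?_⟩ <;>
      refine max_le (max_le ?_ ?_) (max_le ?_ ?_) <;> linarith
  obtain ⟨⟨⟨l1, l2⟩, l3, l4⟩, ⟨u1, u2⟩, u3, u4⟩ := ht
  have key : ∀ N D : ℝ, |N| ≤ D → ∃ κ : ℝ, |κ| ≤ 1 ∧ κ * D = N := by
    intro N D h
    rcases (abs_nonneg N |>.trans h).eq_or_lt with h0 | h0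
    · refine ⟨0, by simp, ?_⟩
      rw [← h0] at h
      simpa using (abs_nonpos_iff.1 h).symm
    · exact ⟨N / D, by rwa [abs_div, abs_of_pos h0, div_le_one h0], div_mul_cancel₀ _ h0.ne'⟩
  obtain ⟨κ₁, h1, e1⟩ := key (c + r + q + t) (1 + a + b + p)
    (abs_le.2 ⟨by linarith, by linarith⟩)
  obtain ⟨κ₂, h2, e2⟩ := key (c - r - q + t) (1 - a - b + p)
    (abs_le.2 ⟨by linarith, by linarith⟩)
  obtain ⟨κ₃, h3, e3⟩ := key (c + r - q - t) (1 + a - b - p)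
    (abs_le.2 ⟨by linarith, by linarith⟩)
  obtain ⟨κ₄, h4, e4⟩ := key (c - r + q - t) (1 - a + b - p)
    (abs_le.2 ⟨by linarith, by linarith⟩)
  refine ⟨(κ₁ + κ₂ + κ₃ + κ₄) / 4, (κ₁ - κ₂ + κ₃ - κ₄) / 4, (κ₁ - κ₂ - κ₃ + κ₄) / 4,
    (κ₁ + κ₂ - κ₃ - κ₄) / 4, ?_, by linarith, by linarith, by linarith⟩
  rintro x y (rfl | rfl) (rfl | rfl)
  · convert h1 using 2; ring
  · convert h3 using 2; ring
  · convert h4 using 2; ring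
  · convert h2 using 2; ring

/-- There is a chain `Z₀, …, Z_k` of `±1`-valued variables on a finite probability space with
expectations `m j`, neighbour correlations `e j`, and end-to-end correlation `r`. -/
def ChainRealizable (m e : ℕ → ℝ) (k : ℕ) (r : ℝ) : Prop :=
  ∃ (Ω : Type) (_ : Fintype Ω) (w : Ω → ℝ) (Z : ℕ → Ω → ℝ),
    (∀ ω, 0 ≤ w ω) ∧ ∑ ω, w ω = 1 ∧ (∀ j ω, Z j ω = 1 ∨ Z j ω = -1) ∧
    (∀ j ≤ k, ∑ ω, w ω * Z j ω = m j) ∧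
    (∀ j < k, ∑ ω, w ω * (Z j ω * Z (j + 1) ω) = e j) ∧
    ∑ ω, w ω * (Z 0 ω * Z k ω) = r

lemma ChainRealizable.zero {m e : ℕ → ℝ} (hm : -1 ≤ m 0 ∧ m 0 ≤ 1) :
    ChainRealizable m e 0 1 := by
  refine ⟨Bool, inferInstance, fun s => if s then (1 + m 0) / 2 else (1 - m 0) / 2,
    fun _ s => if s then 1 else -1, ?_, ?_, ?_, ?_, ?_, ?_⟩
  · rintro (_ | _) <;> simp <;> linarith
  · simp; ring
  · rintro j (_ | _) <;> simp
  · intro j hj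
    obtain rfl : j = 0 := by omega
    simp; ring
  · simp
  · simp; ring

lemma ChainRealizable.succ {m e : ℕ → ℝ} {k : ℕ} {r r' : ℝ} (h : ChainRealizable m e k r)
    (hr : IsPairCorrelation (m 0) (m k) r) (he : IsPairCorrelation (m k) (m (k + 1)) (e k))
    (hr' : IsPairCorrelation (m 0) (m (k + 1)) r') (ht : IsTriangle r (e k) r') :
    ChainRealizable m e (k + 1) r' := by
  obtain ⟨Ω, _, w, Z, hw, hw1, hZ, hZm, hZe, hZr⟩ := h
  obtain ⟨k₀, k₁, k₂, k₃, hκ, hc, hr, hq⟩ := exists_conditional_expectation hr he hr' ht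
  let κ : Ω → ℝ := fun ω => k₀ + k₁ * Z 0 ω + k₂ * Z k ω + k₃ * (Z 0 ω * Z k ω)
  let σ : Bool → ℝ := fun s => if s then 1 else -1
  let w' : Ω × Bool → ℝ := fun p => w p.1 * ((1 + σ p.2 * κ p.1) / 2)
  have hfst : ∀ f : Ω → ℝ, ∑ p, w' p * f p.1 = ∑ ω, w ω * f ω := by
    intro f
    rw [Fintype.sum_prod_type]
    refine Finset.sum_congr rfl fun ω _ => ?_
    simp [w', σ]; ring
  have hsnd : ∀ f : Ω → ℝ, ∑ p, w' p * (f p.1 * σ p.2) = ∑ ω, w ω * (f ω * κ ω) := by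
    intro f
    rw [Fintype.sum_prod_type]
    refine Finset.sum_congr rfl fun ω _ => ?_
    simp [w', σ]; ring
  have hsq : ∀ j ω, Z j ω * Z j ω = 1 := by
    intro j ω
    rcases hZ j ω with h | h <;> simp [h]
  refine ⟨Ω × Bool, inferInstance, w', fun j p => if j ≤ k then Z j p.1 else σ p.2,
    ?_, ?_, ?_, ?_, ?_, ?_⟩
  · rintro ⟨ω, s⟩
    have := abs_le.1 (hκ _ _ (hZ 0 ω) (hZ k ω))
    refine mul_nonneg (hw ω) ?_
    rcases s with _ | _ <;> simp [σ, κ] <;> linarith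
  · simpa [hw1] using hfst fun _ => 1
  · rintro j ⟨ω, s⟩
    dsimp only
    split_ifs
    · exact hZ j ω
    · rcases s with _ | _ <;> simp [σ]
  · intro j hj
    rcases hj.lt_or_eq with hj | rfl
    · have hj : j ≤ k := by omega
      simpa [hj] using (hfst (Z j)).trans (hZm j hj)
    · have := hsnd fun _ => 1
      simp only [one_mul] at this
      simp only [add_le_iff_nonpos_right, nonpos_iff_eq_zero, one_ne_zero, if_false]
      rw [this, ← hc, ← hZm 0 (Nat.zero_le _), ← hZm k le_rfl, ← hZr]
      conv_rhs => rw [← mul_one k₀, ← hw1]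
      simp only [Finset.mul_sum, ← Finset.sum_add_distrib]
      refine Finset.sum_congr rfl fun ω _ => ?_
      simp only [κ]; ring
  · intro j hj
    rcases (Nat.lt_succ_iff.1 hj).lt_or_eq with hj | rfl
    · have h1 : j ≤ k := by omega
      have h2 : j + 1 ≤ k := by omega
      simpa [h1, h2] using (hfst fun ω => Z j ω * Z (j + 1) ω).trans (hZe j hj)
    · simp only [add_le_iff_nonpos_right, nonpos_iff_eq_zero, one_ne_zero, if_false, le_refl,
        if_true]
      rw [hsnd, ← hq, ← hZm 0 (Nat.zero_le _), ← hZm j le_rfl, ← hZr]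
      conv_rhs => rw [← mul_one k₂, ← hw1]
      simp only [Finset.mul_sum, ← Finset.sum_add_distrib]
      refine Finset.sum_congr rfl fun ω _ => ?_
      simp only [κ]
      linear_combination (w ω * (k₂ + k₃ * Z 0 ω)) * hsq j ω
  · simp only [add_le_iff_nonpos_right, nonpos_iff_eq_zero, one_ne_zero, if_false, Nat.zero_le,
      if_true]
    rw [hsnd, ← hr, ← hZm 0 (Nat.zero_le _), ← hZm k le_rfl, ← hZr]
    conv_rhs => rw [← mul_one k₁, ← hw1]
    simp only [Finset.mul_sum, ← Finset.sum_add_distrib]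
    refine Finset.sum_congr rfl fun ω _ => ?_
    simp only [κ]
    linear_combination (w ω * (k₁ + k₃ * Z k ω)) * hsq 0 ω

/-- The bounds that the neighbour correlations `e 0, …, e (k - 1)` of a chain impose on its
end-to-end correlation. -/
def chainBounds (e : ℕ → ℝ) : ℕ → ℝ × ℝ
  | 0 => (1, 1)
  | k + 1 => (max ((chainBounds e k).1 + e k) (-(chainBounds e k).2 - e k) - 1,
      min (1 + (chainBounds e k).2 - e k) (1 + e k - (chainBounds e k).1))

lemma exists_mem_chainBounds {m e : ℕ → ℝ} (hm : ∀ j, -1 ≤ m j ∧ m j ≤ 1)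
    (he : ∀ j, IsPairCorrelation (m j) (m (j + 1)) (e j)) (k : ℕ) :
    ∃ r, IsPairCorrelation (m 0) (m k) r ∧ (chainBounds e k).1 ≤ r ∧ r ≤ (chainBounds e k).2 := by
  induction k with
  | zero =>
    refine ⟨1, isPairCorrelation_iff.2 ⟨?_, ?_, ?_, ?_⟩, le_rfl, le_rfl⟩ <;>
      linarith [(hm 0).1, (hm 0).2]
  | succ k ih =>
    obtain ⟨r, hr, h1, h2⟩ := ih
    obtain ⟨h3, h4⟩ := abs_sum_sub_one_le_of_isPairCorrelation hr (he k)
    have h5 := abs_add_sub_one_le (hm 0) (hm (k + 1))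
    have h6 := abs_add_sub_one_le hr.mem_Icc (he k).mem_Icc
    obtain ⟨r', hr', ht, -⟩ := exists_mem_three_intervals h5 h3 h3 h4 h6 h6 h4 h6 h6
    have ht := isTriangle_iff.1 ht
    refine ⟨r', hr', ?_, ?_⟩
    · simp only [chainBounds, tsub_le_iff_right, max_le_iff]
      constructor <;> linarith
    · simp only [chainBounds, le_min_iff]
      constructor <;> linarith

lemma chainRealizable_of_mem_chainBounds {m e : ℕ → ℝ} (hm : ∀ j, -1 ≤ m j ∧ m j ≤ 1)
    (he : ∀ j, IsPairCorrelation (m j) (m (j + 1)) (e j)) (k : ℕ) {r : ℝ}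
    (hr : IsPairCorrelation (m 0) (m k) r) (hl : (chainBounds e k).1 ≤ r)
    (hu : r ≤ (chainBounds e k).2) : ChainRealizable m e k r := by
  induction k generalizing r with
  | zero =>
    obtain rfl : r = 1 := le_antisymm hu hl
    exact .zero (hm 0)
  | succ k ih =>
    obtain ⟨s, hs, h1, h2⟩ := exists_mem_chainBounds hm he k
    obtain ⟨h3, h4⟩ := abs_sum_sub_one_le_of_isPairCorrelation hr (he k).symm
    have h5 := abs_add_sub_one_le (hm 0) (hm k)
    have h6 := abs_add_sub_one_le hr.mem_Icc (he k).mem_Icc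
    simp only [chainBounds, tsub_le_iff_right, max_le_iff, le_min_iff] at hl hu
    have h7 : (chainBounds e k).1 ≤ 1 - |r - e k| := by
      rcases abs_cases (r - e k) with h | h <;> linarith
    have h8 : |r + e k| - 1 ≤ (chainBounds e k).2 := by
      rcases abs_cases (r + e k) with h | h <;> linarith
    obtain ⟨x, hx1, hx2, hx3⟩ := exists_mem_three_intervals h5 (hs.1.trans h2) h3
      (h1.trans hs.2) (h1.trans h2) h7 h4 h8 h6
    refine (ih hx1 hx2.1 hx2.2).succ hx1 (he k) hr ?_
    have := isTriangle_iff.1 hx3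
    exact isTriangle_iff.2 ⟨by linarith, by linarith, by linarith, by linarith⟩

lemma chainBounds_eq_signed_sum {e : ℕ → ℝ} (he : ∀ j, -1 ≤ e j ∧ e j ≤ 1) (k : ℕ) :
    (∃ ι : ℕ → ℝ, (∀ j, ι j = 1 ∨ ι j = -1) ∧ ∏ j ∈ Finset.range (k + 1), ι j = 1 ∧
      (chainBounds e (k + 1)).1 = ∑ j ∈ Finset.range (k + 1), ι j * e j - k) ∧
    (∃ ι : ℕ → ℝ, (∀ j, ι j = 1 ∨ ι j = -1) ∧ ∏ j ∈ Finset.range (k + 1), ι j = -1 ∧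
      (chainBounds e (k + 1)).2 = k - ∑ j ∈ Finset.range (k + 1), ι j * e j) := by
  have extend : ∀ (ι : ℕ → ℝ) (s : ℝ) (k : ℕ), (∀ j, ι j = 1 ∨ ι j = -1) → (s = 1 ∨ s = -1) →
      ∃ ι' : ℕ → ℝ, (∀ j, ι' j = 1 ∨ ι' j = -1) ∧
        ∏ j ∈ Finset.range (k + 1), ι' j = (∏ j ∈ Finset.range k, ι j) * s ∧
        ∑ j ∈ Finset.range (k + 1), ι' j * e j = ∑ j ∈ Finset.range k, ι j * e j + s * e k := by
    intro ι s k hι hs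
    refine ⟨fun j => if j < k then ι j else s, fun j => ?_, ?_, ?_⟩
    · dsimp only
      split_ifs
      exacts [hι j, hs]
    · rw [Finset.prod_range_succ, if_neg (lt_irrefl k)]
      congr 1
      exact Finset.prod_congr rfl fun j hj => if_pos (Finset.mem_range.1 hj)
    · simp only [Finset.sum_range_succ, lt_irrefl, if_false]
      congr 1
      exact Finset.sum_congr rfl fun j hj => by rw [if_pos (Finset.mem_range.1 hj)]
  induction k with
  | zero =>
    have := he 0
    refine ⟨⟨fun _ => 1, by simp, by simp, ?_⟩, ⟨fun _ => -1, by simp, by simp, ?_⟩⟩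
    · simp only [chainBounds]
      rw [max_eq_left (by linarith)]
      simp
    · simp only [chainBounds]
      rw [min_eq_right (by linarith)]
      simp
  | succ k ih =>
    obtain ⟨⟨ι, hι, hι1, hι2⟩, ⟨τ, hτ, hτ1, hτ2⟩⟩ := ih
    rw [chainBounds]
    dsimp only
    constructor
    · rcases max_choice ((chainBounds e (k + 1)).1 + e (k + 1))
        (-(chainBounds e (k + 1)).2 - e (k + 1)) with h | h
      · obtain ⟨ι', h1, h2, h3⟩ := extend ι 1 (k + 1) hι (by simp)
        refine ⟨ι', h1, by rw [h2, hι1]; norm_num, ?_⟩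
        rw [h, h3, hι2]; push_cast; ring
      · obtain ⟨ι', h1, h2, h3⟩ := extend τ (-1) (k + 1) hτ (by simp)
        refine ⟨ι', h1, by rw [h2, hτ1]; norm_num, ?_⟩
        rw [h, h3, hτ2]; push_cast; ring
    · rcases min_choice (1 + (chainBounds e (k + 1)).2 - e (k + 1))
        (1 + e (k + 1) - (chainBounds e (k + 1)).1) with h | h
      · obtain ⟨ι', h1, h2, h3⟩ := extend τ 1 (k + 1) hτ (by simp)
        refine ⟨ι', h1, by rw [h2, hτ1]; norm_num, ?_⟩
        rw [h, h3, hτ2]; push_cast; ring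
      · obtain ⟨ι', h1, h2, h3⟩ := extend ι (-1) (k + 1) hι (by simp)
        refine ⟨ι', h1, by rw [h2, hι1]; norm_num, ?_⟩
        rw [h, h3, hι2]; push_cast; ring

/-- A cycle of `k + 2` variables is realizable as soon as all odd signed sums of its
correlations are at most `k`. -/
lemma chainRealizable_of_odd_signed_sums_le {m e : ℕ → ℝ} (hm : ∀ j, -1 ≤ m j ∧ m j ≤ 1)
    (he : ∀ j, IsPairCorrelation (m j) (m (j + 1)) (e j)) (k : ℕ)
    (hlast : IsPairCorrelation (m 0) (m (k + 1)) (e (k + 1)))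
    (h : ∀ ι : ℕ → ℝ, (∀ j, ι j = 1 ∨ ι j = -1) → ∏ j ∈ Finset.range (k + 2), ι j = -1 →
      ∑ j ∈ Finset.range (k + 2), ι j * e j ≤ k) :
    ChainRealizable m e (k + 1) (e (k + 1)) := by
  obtain ⟨⟨ι, hι, hι1, hι2⟩, ⟨τ, hτ, hτ1, hτ2⟩⟩ :=
    chainBounds_eq_signed_sum (fun j => (he j).mem_Icc) k
  have extend : ∀ (ι : ℕ → ℝ) (s : ℝ), (∀ j, ι j = 1 ∨ ι j = -1) → (s = 1 ∨ s = -1) →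
      (∏ j ∈ Finset.range (k + 1), ι j) * s = -1 →
      ∑ j ∈ Finset.range (k + 1), ι j * e j + s * e (k + 1) ≤ k := by
    intro ι s hι hs hprod
    have := h (Function.update ι (k + 1) s) (fun j => ?_) ?_
    · rw [Finset.sum_range_succ, Function.update_self] at this
      refine le_of_eq_of_le ?_ this
      congr 1
      refine Finset.sum_congr rfl fun j hj => ?_
      rw [Function.update_of_ne (Finset.mem_range.1 hj).ne]
    · rcases eq_or_ne j (k + 1) with rfl | hj
      · simpa using hs
      · simpa [hj] using hι j
    · rw [Finset.prod_range_succ, Function.update_self, ← hprod]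
      congr 1
      refine Finset.prod_congr rfl fun j hj => ?_
      rw [Function.update_of_ne (Finset.mem_range.1 hj).ne]
  refine chainRealizable_of_mem_chainBounds hm he (k + 1) hlast ?_ ?_
  · linarith [extend ι (-1) hι (by simp) (by rw [hι1]; norm_num)]
  · linarith [extend τ 1 hτ (by simp) (by rw [hτ1]; norm_num)]

/-- Signs with product `−1` include at least one `−1`. -/
lemma sum_le_card_sub_two_of_prod_eq_neg_one {α : Type*} [Fintype α] {y : α → ℝ}
    (hy : ∀ i, y i = 1 ∨ y i = -1) (hprod : ∏ i, y i = -1) :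
    ∑ i, y i ≤ Fintype.card α - 2 := by
  obtain ⟨i, hi⟩ : ∃ i, y i = -1 := by
    by_contra! h
    have : ∏ i, y i = 1 := Finset.prod_eq_one fun i _ => (hy i).resolve_right (h i)
    linarith
  have h1 : 1 - y i ≤ ∑ i, (1 - y i) :=
    Finset.single_le_sum (f := fun i => 1 - y i)
      (fun j _ => by rcases hy j with h | h <;> rw [h] <;> norm_num) (Finset.mem_univ i)
  rw [Finset.sum_sub_distrib] at h1
  simp only [Finset.sum_const, Finset.card_univ, nsmul_eq_mul, mul_one] at h1
  linarith

lemma signed_sum_le_s1 {k : ℕ} {x ι : Fin k → ℝ} (hι : ∀ i, ι i = 1 ∨ ι i = -1)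
    (hprod : ∏ i, ι i = -1) : ∑ i, ι i * x i ≤ s1 x := by
  refine le_csSup ⟨∑ i, |x i|, ?_⟩ ⟨ι, hι, hprod, rfl⟩
  rintro _ ⟨τ, hτ, -, rfl⟩
  refine Finset.sum_le_sum fun i _ => ?_
  rcases hτ i with h | h <;> rw [h]
  · simpa using le_abs_self (x i)
  · simpa using neg_le_abs (x i)

lemma bijective_succ_mod (n : ℕ) :
    Function.Bijective fun i : Fin n =>
      (⟨((i : ℕ) + 1) % n, Nat.mod_lt _ i.pos⟩ : Fin n) := by
  refine Finite.injective_iff_bijective.1 fun i j hij => ?_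
  have h : (i : ℕ) + 1 ≡ j + 1 [MOD n] := by simpa [Nat.ModEq] using hij
  exact Fin.ext ((Nat.ModEq.add_right_cancel' 1 h).eq_of_lt_of_lt i.2 j.2)

lemma prod_range_two_mul {M : Type*} [CommMonoid M] (f : ℕ → M) (n : ℕ) :
    ∏ j ∈ Finset.range (2 * n), f j = (∏ i : Fin n, f (2 * i + 1)) * ∏ i : Fin n, f (2 * i) := by
  rw [Fin.prod_univ_eq_prod_range (fun i => f (2 * i + 1)),
    Fin.prod_univ_eq_prod_range (fun i => f (2 * i))]
  induction n with
  | zero => simp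
  | succ n ih =>
    rw [mul_add, mul_one, Finset.prod_range_succ, Finset.prod_range_succ, ih,
      Finset.prod_range_succ, Finset.prod_range_succ, mul_mul_mul_comm, mul_comm (f (2 * n + 1)),
      mul_assoc]

lemma sum_range_two_mul {M : Type*} [AddCommMonoid M] (f : ℕ → M) (n : ℕ) :
    ∑ j ∈ Finset.range (2 * n), f j = (∑ i : Fin n, f (2 * i + 1)) + ∑ i : Fin n, f (2 * i) :=
  prod_range_two_mul (M := Multiplicative M) f n

/-- The law of a random element `F` on a finite probability space with weights `w`. -/
lemma exists_measure_of_weights {Ω E : Type*} [Fintype Ω] [MeasurableSpace E]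
    [MeasurableSingletonClass E] {w : Ω → ℝ} (hw : ∀ ω, 0 ≤ w ω) (hw1 : ∑ ω, w ω = 1)
    (F : Ω → E) :
    ∃ P : Measure E, IsProbabilityMeasure P ∧ (∀ s : Set E, (∀ ω, F ω ∉ s) → P s = 0) ∧
      ∀ f : E → ℝ, ∫ p, f p ∂P = ∑ ω, w ω * f (F ω) := by
  refine ⟨∑ ω, ENNReal.ofReal (w ω) • Measure.dirac (F ω), ⟨?_⟩, fun s hs => ?_, fun f => ?_⟩
  · simp [← ENNReal.ofReal_sum_of_nonneg fun ω _ => hw ω, hw1]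
  · simp [hs]
  · rw [integral_finsetSum_measure]
    · simp [hw]
    · intro ω _
      exact (integrable_dirac (by simp)).smul_measure ENNReal.ofReal_ne_top

/-- Main (non)contextuality criterion for a cyclic system of rank `n`:
`lam i = ⟨Rᵢⁱ⟩`, `mu i = ⟨Rᵢ^{i⊖1}⟩`, `c i = ⟨Rᵢⁱ R_{i⊕1}ⁱ⟩`.  A probability measure
on `{−1,1}^{2n}` (coordinates `X₁,…,Xₙ,Y₁,…,Yₙ`, encoded as a measure on
`(Fin n → ℝ) × (Fin n → ℝ)`) realizing the context expectations and giving each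
connection pair its maximal correlation exists iff the `s₁` inequality holds. -/
theorem stmt8 (n : ℕ) (hn : 2 ≤ n) (lam mu c : Fin n → ℝ)
    (hlam : ∀ i, -1 ≤ lam i ∧ lam i ≤ 1) (hmu : ∀ i, -1 ≤ mu i ∧ mu i ≤ 1)
    (hc : ∀ i : Fin n,
      |lam i + mu ⟨((i : ℕ) + 1) % n, Nat.mod_lt _ (by omega)⟩| - 1 ≤ c i ∧
      c i ≤ 1 - |lam i - mu ⟨((i : ℕ) + 1) % n, Nat.mod_lt _ (by omega)⟩|) :
    (∃ P : Measure ((Fin n → ℝ) × (Fin n → ℝ)), IsProbabilityMeasure P ∧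
        P {p : (Fin n → ℝ) × (Fin n → ℝ) |
            ¬ ((∀ i, p.1 i = 1 ∨ p.1 i = -1) ∧ (∀ i, p.2 i = 1 ∨ p.2 i = -1))} = 0 ∧
        (∀ i : Fin n, (∫ p, p.1 i ∂P) = lam i) ∧
        (∀ i : Fin n, (∫ p, p.2 i ∂P) = mu i) ∧
        (∀ i : Fin n,
          (∫ p, p.1 i * p.2 ⟨((i : ℕ) + 1) % n, Nat.mod_lt _ (by omega)⟩ ∂P) = c i) ∧
        (∀ i : Fin n, (∫ p, p.2 i * p.1 i ∂P) = 1 - |lam i - mu i|)) ↔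
      s1 (Fin.append c (fun i => 1 - |lam i - mu i|)) ≤ 2 * (n : ℝ) - 2 := by
  have hn0 : 0 < n := by omega
  constructor
  · rintro ⟨P, hP, hsupp, -, -, hXY, hYX⟩
    have hn' : (2 : ℝ) ≤ n := by exact_mod_cast hn
    refine Real.sSup_le ?_ (by linarith)
    rintro _ ⟨ι, hι, hιprod, rfl⟩
    let f : Fin (n + n) → (Fin n → ℝ) × (Fin n → ℝ) → ℝ := fun t p =>
      Fin.append (fun i : Fin n => p.1 i * p.2 ⟨((i : ℕ) + 1) % n, Nat.mod_lt _ (by omega)⟩)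
        (fun i => p.2 i * p.1 i) t
    have hae : ∀ᵐ p ∂P, (∀ i, p.1 i = 1 ∨ p.1 i = -1) ∧ (∀ i, p.2 i = 1 ∨ p.2 i = -1) :=
      ae_iff.2 hsupp
    have hsign : ∀ p : (Fin n → ℝ) × (Fin n → ℝ),
        (∀ i, p.1 i = 1 ∨ p.1 i = -1) ∧ (∀ i, p.2 i = 1 ∨ p.2 i = -1) →
        ∀ t, f t p = 1 ∨ f t p = -1 := by
      rintro p ⟨h1, h2⟩ t
      refine Fin.addCases (fun i => ?_) (fun i => ?_) t
      · simp only [f, Fin.append_left]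
        rcases h1 i with h | h <;>
          rcases h2 ⟨((i : ℕ) + 1) % n, Nat.mod_lt _ hn0⟩ with h' | h' <;> simp [h, h']
      · simp only [f, Fin.append_right]
        rcases h1 i with h | h <;> rcases h2 i with h' | h' <;> simp [h, h']
    have hmeas : ∀ t, Measurable (f t) := by
      refine fun t => Fin.addCases (fun i => ?_) (fun i => ?_) t
      · simp only [f, Fin.append_left]
        fun_prop
      · simp only [f, Fin.append_right]
        fun_prop
    have hint : ∀ t, Integrable (f t) P := fun t =>
      Integrable.of_bound (hmeas t).aestronglyMeasurable 1 <| hae.mono fun p hp => by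
        rcases hsign p hp t with h | h <;> simp [h]
    have hval : ∀ t, ∫ p, f t p ∂P = Fin.append c (fun i => 1 - |lam i - mu i|) t := by
      refine fun t => Fin.addCases (fun i => ?_) (fun i => ?_) t
      · simpa only [f, Fin.append_left] using hXY i
      · simpa only [f, Fin.append_right] using hYX i
    have hprod : ∀ p : (Fin n → ℝ) × (Fin n → ℝ),
        (∀ i, p.1 i = 1 ∨ p.1 i = -1) ∧ (∀ i, p.2 i = 1 ∨ p.2 i = -1) → ∏ t, f t p = 1 := by
      rintro p ⟨h1, h2⟩
      have hperm : ∏ i : Fin n, p.2 ⟨((i : ℕ) + 1) % n, Nat.mod_lt _ hn0⟩ = ∏ i, p.2 i :=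
        (bijective_succ_mod n).prod_comp p.2
      simp only [f, Fin.prod_univ_add, Fin.append_left, Fin.append_right,
        Finset.prod_mul_distrib, hperm]
      simp only [← Finset.prod_mul_distrib]
      refine Finset.prod_eq_one fun i _ => ?_
      rcases h1 i with h | h <;> rcases h2 i with h' | h' <;> simp [h, h']
    calc ∑ t, ι t * Fin.append c (fun i => 1 - |lam i - mu i|) t
        = ∫ p, ∑ t, ι t * f t p ∂P := by
          rw [integral_finsetSum _ fun t _ => (hint t).const_mul _]
          simp only [integral_const_mul, hval]
      _ ≤ ∫ _, (2 * (n : ℝ) - 2) ∂P := by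
          refine integral_mono_ae (integrable_finsetSum _ fun t _ => (hint t).const_mul _)
            (integrable_const _) (hae.mono fun p hp => ?_)
          refine (sum_le_card_sub_two_of_prod_eq_neg_one (fun t => ?_) ?_).trans_eq ?_
          · rcases hι t with h | h <;> rcases hsign p hp t with h' | h' <;> simp [h, h']
          · rw [Finset.prod_mul_distrib, hιprod, hprod p hp, mul_one]
          · simp; ring
      _ = 2 * (n : ℝ) - 2 := by simp
  · intro hs
    let idx : ℕ → Fin n := fun i => ⟨i % n, Nat.mod_lt _ hn0⟩
    have hidx : ∀ i : Fin n, idx i = i := fun i => Fin.ext (Nat.mod_eq_of_lt i.2)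
    let m : ℕ → ℝ := fun j => if j % 2 = 0 then mu (idx (j / 2)) else lam (idx (j / 2))
    let e : ℕ → ℝ := fun j => if j % 2 = 0 then 1 - |lam (idx (j / 2)) - mu (idx (j / 2))|
      else c (idx (j / 2))
    have m_even : ∀ i, m (2 * i) = mu (idx i) := fun i => by simp [m]
    have m_odd : ∀ i, m (2 * i + 1) = lam (idx i) := fun i => by
      simp [m, Nat.add_mod, show (2 * i + 1) / 2 = i by omega]
    have e_even : ∀ i, e (2 * i) = 1 - |lam (idx i) - mu (idx i)| := fun i => by simp [e]
    have e_odd : ∀ i, e (2 * i + 1) = c (idx i) := fun i => by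
      simp [e, Nat.add_mod, show (2 * i + 1) / 2 = i by omega]
    have hc' : ∀ i, IsPairCorrelation (lam (idx i)) (mu (idx (i + 1))) (c (idx i)) := by
      intro i
      have : idx (i + 1) = ⟨((idx i : ℕ) + 1) % n, Nat.mod_lt _ hn0⟩ := Fin.ext (by simp [idx])
      rw [this]
      exact hc (idx i)
    have hm : ∀ j, -1 ≤ m j ∧ m j ≤ 1 := by
      intro j
      simp only [m]
      split_ifs
      exacts [hmu _, hlam _]
    have he : ∀ j, IsPairCorrelation (m j) (m (j + 1)) (e j) := by
      intro j
      obtain ⟨i, rfl | rfl⟩ := Nat.even_or_odd' j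
      · rw [m_even, m_odd, e_even]
        exact IsPairCorrelation.symm ⟨abs_add_sub_one_le (hlam _) (hmu _), le_rfl⟩
      · rw [m_odd, e_odd, show 2 * i + 1 + 1 = 2 * (i + 1) by ring, m_even]
        exact hc' i
    obtain ⟨k, rfl⟩ : ∃ k, n = k + 1 := ⟨n - 1, by omega⟩
    have hlast : IsPairCorrelation (m 0) (m (2 * k + 1)) (e (2 * k + 1)) := by
      have h := hc' k
      have h0 : idx (k + 1) = idx 0 := Fin.ext (by simp [idx])
      rw [h0, ← m_odd, ← m_even, ← e_odd] at h
      exact h.symm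
    have hreal := chainRealizable_of_odd_signed_sums_le hm he (2 * k) hlast fun ι hι hprod => by
      rw [show 2 * k + 2 = 2 * (k + 1) by ring] at hprod ⊢
      rw [prod_range_two_mul] at hprod
      rw [sum_range_two_mul]
      have := (signed_sum_le_s1 (x := Fin.append c (fun i => 1 - |lam i - mu i|))
        (ι := Fin.append (fun i : Fin (k + 1) => ι (2 * i + 1)) (fun i => ι (2 * i)))
        (fun t => Fin.addCases (fun i => by simpa only [Fin.append_left] using hι _)
          (fun i => by simpa only [Fin.append_right] using hι _) t)
        (by rw [Fin.prod_univ_add]; simpa only [Fin.append_left, Fin.append_right] using hprod)).trans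
        hs
      rw [Fin.sum_univ_add] at this
      simp only [Fin.append_left, Fin.append_right] at this
      simp only [e_odd, e_even, hidx]
      push_cast at this ⊢
      linarith
    obtain ⟨Ω, _, w, Z, hw, hw1, hZ, hZm, hZe, hZr⟩ := hreal
    obtain ⟨P, hP, hnull, hintegral⟩ := exists_measure_of_weights hw hw1
      fun ω => ((fun i => Z (2 * i + 1) ω, fun i => Z (2 * i) ω) :
        (Fin (k + 1) → ℝ) × (Fin (k + 1) → ℝ))
    refine ⟨P, hP, hnull _ fun ω => ?_, fun i => ?_, fun i => ?_, fun i => ?_, fun i => ?_⟩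
    · exact not_not.2 ⟨fun i => hZ _ ω, fun i => hZ _ ω⟩
    · rw [hintegral, hZm _ (by omega), m_odd, hidx]
    · rw [hintegral, hZm _ (by omega), m_even, hidx]
    · rw [hintegral]
      rcases (Nat.lt_succ_iff.1 i.2).lt_or_eq with hi | hi
      · have h1 : ((i : ℕ) + 1) % (k + 1) = i + 1 := Nat.mod_eq_of_lt (by omega)
        have h2 := hZe (2 * i + 1) (by omega)
        rw [e_odd, hidx] at h2
        simpa only [h1, mul_add, mul_one, add_assoc] using h2
      · have h1 : ((i : ℕ) + 1) % (k + 1) = 0 := by rw [hi]; simp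
        rw [← hi, e_odd, hidx] at hZr
        simpa only [h1, mul_zero, mul_comm (Z 0 _)] using hZr
    · rw [hintegral, hZe _ (by omega), e_even, hidx]
end

section
/- For any reals x₁,…,xₖ (k ≥ 1), s₁(x₁,…,xₖ) = Σᵢ₌₁ᵏ |xᵢ| − 2·[x₁·x₂·⋯·xₖ > 0]·min(|x₁|,…,|xₖ|), where [P] equals 1 if the predicate P is true and 0 otherwise. -/
/-- The sign of a real number, with the sign of zero taken to be `1`. -/
noncomputable def unitSign (a : ℝ) : ℝ := if a < 0 then -1 else 1

lemma unitSign_eq_or (a : ℝ) : unitSign a = 1 ∨ unitSign a = -1 := by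
  unfold unitSign; split_ifs <;> simp

lemma unitSign_mul_self (a : ℝ) : unitSign a * a = |a| := by
  unfold unitSign
  split_ifs with h
  · rw [abs_of_neg h]; ring
  · rw [abs_of_nonneg (not_lt.mp h)]; ring

lemma sign_mul_le_abs {e : ℝ} (he : e = 1 ∨ e = -1) (a : ℝ) : e * a ≤ |a| := by
  rcases he with rfl | rfl
  · simpa using le_abs_self a
  · simpa using neg_le_abs a

lemma sign_mul_eq_abs_or {e : ℝ} (he : e = 1 ∨ e = -1) (a : ℝ) :
    e * a = |a| ∨ e * a = -|a| := by
  rcases he with rfl | rfl <;> rcases abs_choice a with h | h <;> simp [h]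

lemma prod_sign_eq_or {ι : Type*} (s : Finset ι) {e : ι → ℝ} (he : ∀ i, e i = 1 ∨ e i = -1) :
    ∏ i ∈ s, e i = 1 ∨ ∏ i ∈ s, e i = -1 := by
  refine Finset.prod_induction e (fun r => r = 1 ∨ r = -1) ?_ (Or.inl rfl) fun i _ => he i
  rintro a b (rfl | rfl) (rfl | rfl) <;> simp

lemma prod_unitSign_mul_prod {ι : Type*} [Fintype ι] (x : ι → ℝ) :
    (∏ i, unitSign (x i)) * ∏ i, x i = ∏ i, |x i| := by
  simp only [← Finset.prod_mul_distrib, unitSign_mul_self]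

/-- Changing one sign of an optimal sign vector flips its parity and costs `2 * |x j|`. -/
lemma exists_odd_signs_of_prod_unitSign_eq_one {ι : Type*} [Fintype ι] [DecidableEq ι]
    {x : ι → ℝ} (h : ∏ i, unitSign (x i) = 1) (j : ι) :
    ∃ e : ι → ℝ, (∀ i, e i = 1 ∨ e i = -1) ∧ ∏ i, e i = -1 ∧
      ∑ i, |x i| - 2 * |x j| = ∑ i, e i * x i := by
  refine ⟨fun i => unitSign (x i) * if i = j then -1 else 1, fun i => ?_, ?_, ?_⟩
  · rcases unitSign_eq_or (x i) with h | h <;> by_cases hij : i = j <;> simp_all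
  · rw [Finset.prod_mul_distrib, h]; simp
  · have key : ∀ i, (unitSign (x i) * if i = j then -1 else 1) * x i
        = |x i| - if i = j then 2 * |x j| else 0 := by
      intro i
      rw [mul_right_comm, unitSign_mul_self]
      split_ifs with hij
      · subst hij; ring
      · ring
    simp only [key, Finset.sum_sub_distrib, Finset.sum_ite_eq', Finset.mem_univ, if_true]

lemma sum_sign_mul_le_of_eq_neg_abs {ι : Type*} [Fintype ι] [DecidableEq ι] {x e : ι → ℝ}
    (he : ∀ i, e i = 1 ∨ e i = -1) {j : ι} (hj : e j * x j = -|x j|) :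
    ∑ i, e i * x i ≤ ∑ i, |x i| - 2 * |x j| := by
  have key : ∀ i, e i * x i ≤ |x i| - if i = j then 2 * |x j| else 0 := by
    intro i
    split_ifs with hij
    · subst hij; linarith
    · simpa using sign_mul_le_abs (he i) (x i)
  calc ∑ i, e i * x i ≤ ∑ i, (|x i| - if i = j then 2 * |x j| else 0) :=
        Finset.sum_le_sum fun i _ => key i
    _ = _ := by simp [Finset.sum_sub_distrib]

theorem stmt11 (k : ℕ) (hk : 1 ≤ k) (x : Fin k → ℝ) :
    s1 x = ∑ i, |x i| -
      2 * (if 0 < ∏ i, x i then (1 : ℝ) else 0) *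
        Finset.univ.inf' ⟨⟨0, by omega⟩, Finset.mem_univ _⟩ (fun i => |x i|) := by
  have hne : (Finset.univ : Finset (Fin k)).Nonempty := ⟨⟨0, by omega⟩, Finset.mem_univ _⟩
  have habs : 0 ≤ ∏ i, |x i| := Finset.prod_nonneg fun i _ => abs_nonneg _
  have hmul := prod_unitSign_mul_prod x
  have hsign := prod_sign_eq_or Finset.univ fun i => unitSign_eq_or (x i)
  refine IsGreatest.csSup_eq ?_
  split_ifs with hpos
  · rw [mul_one]
    constructor
    · have hone : ∏ i, unitSign (x i) = 1 := by
        refine hsign.resolve_right fun h => ?_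
        rw [h] at hmul
        linarith
      obtain ⟨j, -, hj⟩ := Finset.exists_mem_eq_inf' hne fun i => |x i|
      rw [hj]
      exact exists_odd_signs_of_prod_unitSign_eq_one hone j
    · rintro y ⟨e, he, hprod, rfl⟩
      obtain ⟨j, hj⟩ : ∃ j, e j * x j = -|x j| := by
        by_contra! hcon
        have h : ∏ i, e i * x i = ∏ i, |x i| :=
          Finset.prod_congr rfl fun i _ => (sign_mul_eq_abs_or (he i) (x i)).resolve_right (hcon i)
        rw [Finset.prod_mul_distrib, hprod] at h
        linarith
      have hmin := Finset.inf'_le (fun i => |x i|) (Finset.mem_univ j)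
      have hle := sum_sign_mul_le_of_eq_neg_abs he hj
      linarith
  · rw [mul_zero, zero_mul, sub_zero]
    constructor
    · rcases hsign with h | h
      · have hzero : ∏ i, x i = 0 := by
          rw [h, one_mul] at hmul
          linarith
        obtain ⟨j, -, hj⟩ := Finset.prod_eq_zero_iff.mp hzero
        simpa [hj] using exists_odd_signs_of_prod_unitSign_eq_one h j
      · exact ⟨fun i => unitSign (x i), fun i => unitSign_eq_or (x i), h, by
          simp only [unitSign_mul_self]⟩
    · rintro y ⟨e, he, -, rfl⟩
      exact Finset.sum_le_sum fun i _ => sign_mul_le_abs (he i) (x i)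
end

section
/- Let p₁,…,p₅ be reals with pᵢ ≥ 0 and pᵢ + pᵢ₊₁ ≤ 1 for all i = 1,…,5 (indices cyclic, so p₆ means p₁). Then s₁(1 − 2(p₁+p₂), 1 − 2(p₂+p₃), 1 − 2(p₃+p₄), 1 − 2(p₄+p₅), 1 − 2(p₅+p₁)) ≤ 3 if and only if p₁ + p₂ + p₃ + p₄ + p₅ ≤ 2. -/
/-- Every signed sum with an odd number of minus signs is bounded above by the sum of the
absolute values. -/
lemma bddAbove_signed_sums {k : ℕ} (x : Fin k → ℝ) :
    BddAbove {y | ∃ ι : Fin k → ℝ,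
      (∀ i, ι i = 1 ∨ ι i = -1) ∧ (∏ i, ι i) = -1 ∧ y = ∑ i, ι i * x i} := by
  refine ⟨∑ i, |x i|, ?_⟩
  rintro y ⟨ι, hι, -, rfl⟩
  refine Finset.sum_le_sum fun i _ => ?_
  rcases hι i with h | h
  · simpa [h] using le_abs_self (x i)
  · simpa [h] using neg_le_abs (x i)

theorem stmt13 (p : Fin 5 → ℝ) (hp : ∀ i, 0 ≤ p i) (hsum : ∀ i, p i + p (i + 1) ≤ 1) :
    s1 ![1 - 2 * (p 0 + p 1), 1 - 2 * (p 1 + p 2), 1 - 2 * (p 2 + p 3),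
        1 - 2 * (p 3 + p 4), 1 - 2 * (p 4 + p 0)] ≤ 3 ↔
      p 0 + p 1 + p 2 + p 3 + p 4 ≤ 2 := by
  have all_neg_mem : (∀ i : Fin 5, (-1 : ℝ) = 1 ∨ (-1 : ℝ) = -1) ∧ ∏ _i : Fin 5, (-1 : ℝ) = -1 :=
    ⟨fun _ => Or.inr rfl, by norm_num [Fin.prod_univ_five]⟩
  constructor
  · intro h
    have hle := (le_csSup (bddAbove_signed_sums _)
      ⟨fun _ => -1, all_neg_mem.1, all_neg_mem.2, rfl⟩).trans h
    simp [Fin.sum_univ_five] at hle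
    linarith
  · intro h
    refine csSup_le ⟨_, fun _ => -1, all_neg_mem.1, all_neg_mem.2, rfl⟩ ?_
    rintro y ⟨ι, hι, hprod, rfl⟩
    have h0 : p 0 + p 1 ≤ 1 := hsum 0
    have h1 : p 1 + p 2 ≤ 1 := hsum 1
    have h2 : p 2 + p 3 ≤ 1 := hsum 2
    have h3 : p 3 + p 4 ≤ 1 := hsum 3
    have h4 : p 4 + p 0 ≤ 1 := hsum 4
    have := hp 0
    have := hp 1
    have := hp 2
    have := hp 3
    have := hp 4
    rw [Fin.prod_univ_five] at hprod
    rcases hι 0 with e0 | e0 <;> rcases hι 1 with e1 | e1 <;> rcases hι 2 with e2 | e2 <;>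
      rcases hι 3 with e3 | e3 <;> rcases hι 4 with e4 | e4 <;>
      rw [e0, e1, e2, e3, e4] at hprod <;>
      first
      | (exfalso; norm_num at hprod; done)
      | (simp [Fin.sum_univ_five, e0, e1, e2, e3, e4]; linarith)
end

section
/- Let v₁, v₂, v₃, c₁, c₂ be reals with −1 ≤ vᵢ ≤ 1 for i = 1, 2, 3, |v₁ + v₂| − 1 ≤ c₁ ≤ 1 − |v₁ − v₂|, and |v₂ + v₃| − 1 ≤ c₂ ≤ 1 − |v₂ − v₃|. Then for a real t there exists a probability measure on {−1,1}³ ⊆ ℝ³ with ⟨A₁⟩ = v₁, ⟨A₂⟩ = v₂, ⟨A₃⟩ = v₃, ⟨A₁A₂⟩ = c₁, ⟨A₂A₃⟩ = c₂, and ⟨A₃A₁⟩ = t if and only if s₁(c₁, c₂) + t ≤ 1, s₀(c₁, c₂) − t ≤ 1, and |v₃ + v₁| − 1 ≤ t ≤ 1 − |v₃ − v₁|. -/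
open MeasureTheory

/-- `s₀(x₁,…,xₖ)`: the maximum of `∑ ιᵢ xᵢ` over sign vectors `ι ∈ {−1,1}ᵏ`
with an even number of `−1`'s (equivalently, `∏ ιᵢ = 1`). -/
noncomputable def s0 {k : ℕ} (x : Fin k → ℝ) : ℝ :=
  sSup {y | ∃ ι : Fin k → ℝ, (∀ i, ι i = 1 ∨ ι i = -1) ∧ (∏ i, ι i) = 1 ∧ y = ∑ i, ι i * x i}

theorem s1_pair (a b : ℝ) : s1 ![a, b] = |a - b| := by
  refine IsGreatest.csSup_eq ⟨?_, ?_⟩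
  · rcases abs_cases (a - b) with ⟨h, -⟩ | ⟨h, -⟩
    · refine ⟨![1, -1], by simp [Fin.forall_fin_two], by simp, ?_⟩
      rw [h]
      simp [sub_eq_add_neg]
    · refine ⟨![-1, 1], by simp [Fin.forall_fin_two], by simp, ?_⟩
      rw [h]
      simp [sub_eq_add_neg, add_comm]
  · rintro y ⟨ι, hι, hprod, rfl⟩
    have h0 := hι 0
    have h1 := hι 1
    simp only [Fin.prod_univ_two, Fin.sum_univ_two, Matrix.cons_val_zero,
      Matrix.cons_val_one] at hprod ⊢
    rcases h0 with h0 | h0 <;> rcases h1 with h1 | h1 <;> rw [h0, h1] at hprod ⊢ <;>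
      norm_num at hprod <;> linarith [le_abs_self (a - b), neg_abs_le (a - b)]

theorem s0_pair (a b : ℝ) : s0 ![a, b] = |a + b| := by
  refine IsGreatest.csSup_eq ⟨?_, ?_⟩
  · rcases abs_cases (a + b) with ⟨h, -⟩ | ⟨h, -⟩
    · refine ⟨![1, 1], by simp [Fin.forall_fin_two], by simp, ?_⟩
      simp [h]
    · refine ⟨![-1, -1], by simp [Fin.forall_fin_two], by simp, ?_⟩
      simp [h, add_comm]
  · rintro y ⟨ι, hι, hprod, rfl⟩
    have h0 := hι 0
    have h1 := hι 1
    simp only [Fin.prod_univ_two, Fin.sum_univ_two, Matrix.cons_val_zero,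
      Matrix.cons_val_one] at hprod ⊢
    rcases h0 with h0 | h0 <;> rcases h1 with h1 | h1 <;> rw [h0, h1] at hprod ⊢ <;>
      norm_num at hprod <;> linarith [le_abs_self (a + b), neg_abs_le (a + b)]

/-- The coordinates and their pairwise products are integrable for a sign measure, being bounded
almost everywhere. -/
theorem IsSignProb3.integrable {μ : Measure (ℝ × ℝ × ℝ)} (h : IsSignProb3 μ)
    {f : ℝ × ℝ × ℝ → ℝ} (hf : Continuous f)
    (hb : ∀ x y z : ℝ, (x = 1 ∨ x = -1) → (y = 1 ∨ y = -1) → (z = 1 ∨ z = -1) →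
      |f (x, y, z)| ≤ 1) : Integrable f μ := by
  have := h.1
  refine Integrable.of_bound hf.aestronglyMeasurable 1 ?_
  have h2 := h.2
  rw [← ae_iff] at h2
  filter_upwards [h2] with p hp
  exact hb p.1 p.2.1 p.2.2 hp.1 hp.2.1 hp.2.2

/-- Taking expectations, an inequality between an affine combination of the coordinates and their
pairwise products that holds at all sign vectors also holds for the first and second moments. -/
theorem IsSignProb3.moment_nonneg {μ : Measure (ℝ × ℝ × ℝ)} (h : IsSignProb3 μ)
    (d₁ d₂ d₃ e₁ e₂ e₃ : ℝ)
    (hpos : ∀ x y z : ℝ, (x = 1 ∨ x = -1) → (y = 1 ∨ y = -1) → (z = 1 ∨ z = -1) →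
      0 ≤ 1 + d₁ * x + d₂ * y + d₃ * z + e₁ * (x * y) + e₂ * (y * z) + e₃ * (z * x)) :
    0 ≤ 1 + d₁ * (∫ p, p.1 ∂μ) + d₂ * (∫ p, p.2.1 ∂μ) + d₃ * (∫ p, p.2.2 ∂μ) +
      e₁ * (∫ p, p.1 * p.2.1 ∂μ) + e₂ * (∫ p, p.2.1 * p.2.2 ∂μ) +
      e₃ * (∫ p, p.2.2 * p.1 ∂μ) := by
  have := h.1
  have key : 0 ≤ ∫ p, (1 + d₁ * p.1 + d₂ * p.2.1 + d₃ * p.2.2 + e₁ * (p.1 * p.2.1) +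
      e₂ * (p.2.1 * p.2.2) + e₃ * (p.2.2 * p.1)) ∂μ := by
    refine integral_nonneg_of_ae ?_
    have h2 := h.2
    rw [← ae_iff] at h2
    filter_upwards [h2] with p hp
    exact hpos p.1 p.2.1 p.2.2 hp.1 hp.2.1 hp.2.2
  have i0 : Integrable (fun _ : ℝ × ℝ × ℝ => (1 : ℝ)) μ := integrable_const 1
  have i1 : Integrable (fun p : ℝ × ℝ × ℝ => d₁ * p.1) μ :=
    (h.integrable (by fun_prop) (by rintro x y z (rfl | rfl) - - <;> simp)).const_mul _
  have i2 : Integrable (fun p : ℝ × ℝ × ℝ => d₂ * p.2.1) μ :=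
    (h.integrable (by fun_prop) (by rintro x y z - (rfl | rfl) - <;> simp)).const_mul _
  have i3 : Integrable (fun p : ℝ × ℝ × ℝ => d₃ * p.2.2) μ :=
    (h.integrable (by fun_prop) (by rintro x y z - - (rfl | rfl) <;> simp)).const_mul _
  have i4 : Integrable (fun p : ℝ × ℝ × ℝ => e₁ * (p.1 * p.2.1)) μ :=
    (h.integrable (by fun_prop)
      (by rintro x y z (rfl | rfl) (rfl | rfl) - <;> simp)).const_mul _
  have i5 : Integrable (fun p : ℝ × ℝ × ℝ => e₂ * (p.2.1 * p.2.2)) μ :=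
    (h.integrable (by fun_prop)
      (by rintro x y z - (rfl | rfl) (rfl | rfl) <;> simp)).const_mul _
  have i6 : Integrable (fun p : ℝ × ℝ × ℝ => e₃ * (p.2.2 * p.1)) μ :=
    (h.integrable (by fun_prop)
      (by rintro x y z (rfl | rfl) - (rfl | rfl) <;> simp)).const_mul _
  have j1 : Integrable (fun p : ℝ × ℝ × ℝ => 1 + d₁ * p.1) μ := i0.add i1
  have j2 : Integrable (fun p : ℝ × ℝ × ℝ => 1 + d₁ * p.1 + d₂ * p.2.1) μ := j1.add i2
  have j3 : Integrable (fun p : ℝ × ℝ × ℝ => 1 + d₁ * p.1 + d₂ * p.2.1 + d₃ * p.2.2) μ :=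
    j2.add i3
  have j4 : Integrable (fun p : ℝ × ℝ × ℝ => 1 + d₁ * p.1 + d₂ * p.2.1 + d₃ * p.2.2 +
      e₁ * (p.1 * p.2.1)) μ := j3.add i4
  have j5 : Integrable (fun p : ℝ × ℝ × ℝ => 1 + d₁ * p.1 + d₂ * p.2.1 + d₃ * p.2.2 +
      e₁ * (p.1 * p.2.1) + e₂ * (p.2.1 * p.2.2)) μ := j4.add i5
  rw [integral_add j5 i6, integral_add j4 i5, integral_add j3 i4, integral_add j2 i3,
    integral_add j1 i2, integral_add i0 i1] at key
  simpa only [integral_const_mul, integral_const, probReal_univ, one_smul] using key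

/-- A finite family of points, weighted by nonnegative reals, as a measure. -/
noncomputable def weightedDirac {ι α : Type*} [Fintype ι] [MeasurableSpace α]
    (w : ι → ℝ) (x : ι → α) : Measure α :=
  ∑ i, ENNReal.ofReal (w i) • Measure.dirac (x i)

theorem integral_weightedDirac {ι α : Type*} [Fintype ι] [MeasurableSpace α]
    [MeasurableSingletonClass α] {w : ι → ℝ} (hw : ∀ i, 0 ≤ w i) (x : ι → α) (f : α → ℝ) :
    ∫ a, f a ∂(weightedDirac w x) = ∑ i, w i * f (x i) := by
  rw [weightedDirac, integral_finsetSum_measure]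
  · simp [integral_smul_measure, hw]
  · intro i _
    exact (integrable_dirac (by simp)).smul_measure ENNReal.ofReal_ne_top

/-- The real sign attached to a Boolean. -/
def boolSign (b : Bool) : ℝ := if b then 1 else -1

theorem boolSign_eq (b : Bool) : boolSign b = 1 ∨ boolSign b = -1 := by
  cases b <;> simp [boolSign]

/-- The sign vector attached to a triple of Booleans. -/
def signPoint (i : Bool × Bool × Bool) : ℝ × ℝ × ℝ :=
  (boolSign i.1, boolSign i.2.1, boolSign i.2.2)

theorem isSignProb3_weightedDirac {w : Bool × Bool × Bool → ℝ} (hw : ∀ i, 0 ≤ w i)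
    (hsum : ∑ i, w i = 1) : IsSignProb3 (weightedDirac w signPoint) := by
  refine ⟨⟨?_⟩, ?_⟩
  · simp [weightedDirac, ← ENNReal.ofReal_sum_of_nonneg (fun i _ => hw i), hsum]
  · simp only [weightedDirac, Measure.coe_finsetSum, Finset.sum_apply, Measure.smul_apply,
      smul_eq_mul]
    refine Finset.sum_eq_zero fun i _ => ?_
    rw [Measure.dirac_apply]
    rw [Set.indicator_of_notMem, mul_zero]
    exact not_not_intro ⟨boolSign_eq _, boolSign_eq _, boolSign_eq _⟩

/-- The weight at the sign vector `(x, y, z)` of the signed measure on `{−1,1}³` with prescribed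
first, second and third moments. -/
noncomputable def signWeight (v₁ v₂ v₃ c₁ c₂ c₃ w x y z : ℝ) : ℝ :=
  (1 + v₁ * x + v₂ * y + v₃ * z + c₁ * (x * y) + c₂ * (y * z) + c₃ * (z * x) +
    w * (x * y * z)) / 8

theorem exists_signWeight_nonneg {v₁ v₂ v₃ c₁ c₂ t : ℝ}
    (hc₁ : |v₁ + v₂| - 1 ≤ c₁ ∧ c₁ ≤ 1 - |v₁ - v₂|)
    (hc₂ : |v₂ + v₃| - 1 ≤ c₂ ∧ c₂ ≤ 1 - |v₂ - v₃|)
    (hs₁ : |c₁ - c₂| + t ≤ 1) (hs₀ : |c₁ + c₂| - t ≤ 1)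
    (ht : |v₃ + v₁| - 1 ≤ t ∧ t ≤ 1 - |v₃ - v₁|) :
    ∃ w : ℝ, ∀ i : Bool × Bool × Bool, 0 ≤ signWeight v₁ v₂ v₃ c₁ c₂ t w
      (boolSign i.1) (boolSign i.2.1) (boolSign i.2.2) := by
  have a₁ := abs_le.1 (show |v₁ + v₂| ≤ 1 + c₁ by linarith)
  have a₂ := abs_le.1 (show |v₁ - v₂| ≤ 1 - c₁ by linarith)
  have a₃ := abs_le.1 (show |v₂ + v₃| ≤ 1 + c₂ by linarith)
  have a₄ := abs_le.1 (show |v₂ - v₃| ≤ 1 - c₂ by linarith)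
  have a₅ := abs_le.1 (show |v₃ + v₁| ≤ 1 + t by linarith)
  have a₆ := abs_le.1 (show |v₃ - v₁| ≤ 1 - t by linarith)
  have a₇ := abs_le.1 (show |c₁ - c₂| ≤ 1 - t by linarith)
  have a₈ := abs_le.1 (show |c₁ + c₂| ≤ 1 + t by linarith)
  have interpolate : ∀ l₁ l₂ l₃ l₄ u₁ u₂ u₃ u₄ : ℝ,
      (∀ l, (l = l₁ ∨ l = l₂ ∨ l = l₃ ∨ l = l₄) → l ≤ u₁ ∧ l ≤ u₂ ∧ l ≤ u₃ ∧ l ≤ u₄) →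
      ∃ w, (l₁ ≤ w ∧ l₂ ≤ w ∧ l₃ ≤ w ∧ l₄ ≤ w) ∧ w ≤ u₁ ∧ w ≤ u₂ ∧ w ≤ u₃ ∧ w ≤ u₄ := by
    intro l₁ l₂ l₃ l₄ u₁ u₂ u₃ u₄ h
    refine ⟨max (max l₁ l₂) (max l₃ l₄), by simp, h _ ?_⟩
    rcases max_choice l₁ l₂ with h₁ | h₁ <;> rcases max_choice l₃ l₄ with h₂ | h₂ <;>
      rw [h₁, h₂] <;> grind
  obtain ⟨w, ⟨h₁, h₂, h₃, h₄⟩, h₅, h₆, h₇, h₈⟩ := interpolate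
    (-(1 + v₁ + v₂ + v₃ + c₁ + c₂ + t)) (-(1 + v₁ - v₂ - v₃ - c₁ + c₂ - t))
    (-(1 - v₁ + v₂ - v₃ - c₁ - c₂ + t)) (-(1 - v₁ - v₂ + v₃ + c₁ - c₂ - t))
    (1 - v₁ - v₂ - v₃ + c₁ + c₂ + t) (1 - v₁ + v₂ + v₃ - c₁ + c₂ - t)
    (1 + v₁ - v₂ + v₃ - c₁ - c₂ + t) (1 + v₁ + v₂ - v₃ + c₁ - c₂ - t) (by
      rintro l (rfl | rfl | rfl | rfl) <;> refine ⟨?_, ?_, ?_, ?_⟩ <;> linarith)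
  refine ⟨w, ?_⟩
  rintro ⟨_ | _, _ | _, _ | _⟩ <;> norm_num [signWeight, boolSign] <;> linarith

theorem stmt16 (v₁ v₂ v₃ c₁ c₂ : ℝ)
    (hv₁ : -1 ≤ v₁ ∧ v₁ ≤ 1) (hv₂ : -1 ≤ v₂ ∧ v₂ ≤ 1) (hv₃ : -1 ≤ v₃ ∧ v₃ ≤ 1)
    (hc₁ : |v₁ + v₂| - 1 ≤ c₁ ∧ c₁ ≤ 1 - |v₁ - v₂|)
    (hc₂ : |v₂ + v₃| - 1 ≤ c₂ ∧ c₂ ≤ 1 - |v₂ - v₃|) (t : ℝ) :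
    (∃ μ : Measure (ℝ × ℝ × ℝ), IsSignProb3 μ ∧
        (∫ p, p.1 ∂μ) = v₁ ∧ (∫ p, p.2.1 ∂μ) = v₂ ∧ (∫ p, p.2.2 ∂μ) = v₃ ∧
        (∫ p, p.1 * p.2.1 ∂μ) = c₁ ∧ (∫ p, p.2.1 * p.2.2 ∂μ) = c₂ ∧
        (∫ p, p.2.2 * p.1 ∂μ) = t) ↔
      s1 ![c₁, c₂] + t ≤ 1 ∧ s0 ![c₁, c₂] - t ≤ 1 ∧
        |v₃ + v₁| - 1 ≤ t ∧ t ≤ 1 - |v₃ - v₁| := by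
  rw [s1_pair, s0_pair]
  constructor
  · rintro ⟨μ, hμ, h₁, h₂, h₃, h₁₂, h₂₃, h₃₁⟩
    have key := hμ.moment_nonneg
    rw [h₁, h₂, h₃, h₁₂, h₂₃, h₃₁] at key
    have triple : ∀ a b c : ℝ, (a = 1 ∨ a = -1) → (b = 1 ∨ b = -1) → c = a * b →
        0 ≤ 1 + a * c₁ + b * c₂ + c * t := by
      rintro a b c ha hb rfl
      have := key 0 0 0 a b (a * b) (by
        rintro x y z (rfl | rfl) (rfl | rfl) (rfl | rfl) <;>
          rcases ha with rfl | rfl <;> rcases hb with rfl | rfl <;> norm_num)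
      linarith
    have pair : ∀ a b : ℝ, (a = 1 ∨ a = -1) → (b = 1 ∨ b = -1) →
        0 ≤ 1 + a * v₁ + b * v₃ + a * b * t := by
      intro a b ha hb
      have := key a 0 b 0 0 (a * b) (by
        rintro x y z (rfl | rfl) - (rfl | rfl) <;>
          rcases ha with rfl | rfl <;> rcases hb with rfl | rfl <;> norm_num)
      linarith
    have t₁ := triple 1 1 1 (by simp) (by simp) (by simp)
    have t₂ := triple 1 (-1) (-1) (by simp) (by simp) (by simp)
    have t₃ := triple (-1) 1 (-1) (by simp) (by simp) (by simp)
    have t₄ := triple (-1) (-1) 1 (by simp) (by simp) (by simp)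
    have p₁ := pair 1 1 (by simp) (by simp)
    have p₂ := pair 1 (-1) (by simp) (by simp)
    have p₃ := pair (-1) 1 (by simp) (by simp)
    have p₄ := pair (-1) (-1) (by simp) (by simp)
    refine ⟨?_, ?_, ?_, ?_⟩
    · linarith [abs_le.2 (show -(1 - t) ≤ c₁ - c₂ ∧ c₁ - c₂ ≤ 1 - t by constructor <;> linarith)]
    · linarith [abs_le.2 (show -(1 + t) ≤ c₁ + c₂ ∧ c₁ + c₂ ≤ 1 + t by constructor <;> linarith)]
    · linarith [abs_le.2 (show -(1 + t) ≤ v₃ + v₁ ∧ v₃ + v₁ ≤ 1 + t by constructor <;> linarith)]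
    · linarith [abs_le.2 (show -(1 - t) ≤ v₃ - v₁ ∧ v₃ - v₁ ≤ 1 - t by constructor <;> linarith)]
  · rintro ⟨hs₁, hs₀, ht⟩
    obtain ⟨w, hw⟩ := exists_signWeight_nonneg hc₁ hc₂ hs₁ hs₀ ht
    refine ⟨_, isSignProb3_weightedDirac hw ?_, ?_, ?_, ?_, ?_, ?_, ?_⟩
    · simp [Fintype.sum_prod_type, signWeight, boolSign]
      ring
    all_goals
      rw [integral_weightedDirac hw]
      simp [Fintype.sum_prod_type, signWeight, boolSign, signPoint]
      ring
end
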